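/- Over an algebraically closed field k of characteristic ≠ 2,3, the field L of invariant rational functions for the action of GL_2(k) × Γ on k(A_0,...,A_3, B_0,...,B_3) (the function field of pairs of binary cubics, where Γ is generated by scalings (f,g) ↦ (cf, c^{-1}g) and the swap (f,g) ↦ (g,f)) is the rational function field k(R_1, R_2, R_3), where R_1 = H^2/I, R_2 = H^3/R, R_3 = H^4/D. -/

import Mathlib

open MvPolynomial
noncomputable section

/-- The binary form of degree `d` with coefficient vector `a`. -/
def toForm (k : Type*) [CommSemiring k] (d : ℕ) (a : Fin (d+1) → k) :
    MvPolynomial (Fin 2) k :=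
  ∑ i : Fin (d+1), C (a i) * X 0 ^ (d - (i : ℕ)) * X 1 ^ (i : ℕ)

/-- Coordinate change by the matrix `g` : `X ↦ g00 X + g01 Y`, `Y ↦ g10 X + g11 Y`. -/
def matAct (k : Type*) [CommSemiring k] (g : Matrix (Fin 2) (Fin 2) k)
    (p : MvPolynomial (Fin 2) k) : MvPolynomial (Fin 2) k :=
  aeval (fun j : Fin 2 => C (g j 0) * X 0 + C (g j 1) * X 1) p

/-- The coefficient of `X^(d-i) Y^i` in a binary form of degree `d`. -/
def formCoeff (k : Type*) [CommSemiring k] (d : ℕ) (p : MvPolynomial (Fin 2) k)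
    (i : Fin (d+1)) : k :=
  coeff (Finsupp.single 0 (d - (i : ℕ)) + Finsupp.single 1 (i : ℕ)) p

/-- The induced action of a `2×2` matrix on the coefficient vector of a binary form. -/
def actCoeff (k : Type*) [CommSemiring k] (d : ℕ) (g : Matrix (Fin 2) (Fin 2) k)
    (a : Fin (d+1) → k) : Fin (d+1) → k :=
  formCoeff k d (matAct k g (toForm k d a))

/-- `P ∈ k[A_0,…,A_d]` is an `SL₂(k)`-invariant. -/
def SL2Invariant (k : Type*) [CommRing k] (d : ℕ)
    (P : MvPolynomial (Fin (d+1)) k) : Prop :=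
  ∀ g : Matrix.SpecialLinearGroup (Fin 2) k, ∀ a : Fin (d+1) → k,
    eval (actCoeff k d (g : Matrix (Fin 2) (Fin 2) k) a) P = eval a P

/-- The ring `R_d` of `SL₂(k)`-invariants in `k[A_0,…,A_d]`. -/
def Rd (k : Type*) [Field k] (d : ℕ) : Subalgebra k (MvPolynomial (Fin (d+1)) k) where
  carrier := {P | SL2Invariant k d P}
  mul_mem' := fun hP hQ g a => by simp only [map_mul]; rw [hP g a, hQ g a]
  add_mem' := fun hP hQ g a => by simp only [map_add]; rw [hP g a, hQ g a]
  algebraMap_mem' := fun r g a => by simp [SL2Invariant]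
/-- The skew-symmetric `SL₂`-invariant pairing `H` on pairs of binary cubics. -/
def Hc {A : Type*} [CommRing A] (a b : Fin 4 → A) : A :=
  3 * a 0 * b 3 - a 1 * b 2 + a 2 * b 1 - 3 * a 3 * b 0

/-- The discriminant of a binary cubic. -/
def discCubic {A : Type*} [CommRing A] (a : Fin 4 → A) : A :=
  -27 * a 0^2 * a 3^2 + 18 * a 0 * a 3 * a 2 * a 1 + a 1^2 * a 2^2
    - 4 * a 1^3 * a 3 - 4 * a 2^3 * a 0

/-- `D = D_f D_g`, the product of the discriminants of the two cubics. -/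
def Dc {A : Type*} [CommRing A] (a b : Fin 4 → A) : A :=
  discCubic a * discCubic b

/-- The resultant `R` of two binary cubics. -/
def Rc {A : Type*} [CommRing A] (a b : Fin 4 → A) : A :=
  3*b 0^2*a 0*b 3*a 3^2 - b 0^3*a 3^3 + 2*b 0^2*a 3^2*b 2*a 1 - b 2^2*b 0*a 1^2*a 3
  - a 0^2*b 2^3*a 3 + b 0^2*a 2*b 1*a 3^2 - b 0^2*a 2^2*b 2*a 3 - b 1^2*b 0*a 1*a 3^2
  + a 0*b 1^3*a 3^2 - 3*b 0*a 0^2*b 3^2*a 3 - b 0*a 1^3*b 3^2 + a 0^3*b 3^3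
  + b 0^2*a 2^3*b 3 - b 0*a 0*b 3*b 2*a 1*a 3 + 3*a 0^2*b 3*b 2*b 1*a 3
  + b 0*a 3*b 3*a 0*b 1*a 2 + 3*b 0*a 0*b 3^2*a 1*a 2 - 2*a 0^2*b 3^2*b 1*a 2
  - 3*b 0*a 3^2*b 2*a 0*b 1 - 3*b 0^2*a 3*b 3*a 1*a 2 - b 2*a 1*a 0^2*b 3^2
  + b 2^2*a 1*a 0*b 1*a 3 + b 2*b 0*a 1^2*b 3*a 2 - b 2*a 1*b 3*a 0*b 1*a 2
  + a 0^2*b 2^2*a 2*b 3 + 2*b 0*a 0*b 2^2*a 2*a 3 - 2*b 0*a 0*b 2*b 3*a 2^2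
  - 2*b 1^2*a 1*a 3*a 0*b 3 + b 1*a 1^2*b 3^2*a 0 + 2*b 1*b 0*a 1^2*b 3*a 3
  + b 1*b 0*a 1*b 2*a 2*a 3 - b 1*b 0*a 1*b 3*a 2^2 - a 0*b 1^2*b 2*a 2*a 3
  + a 0*b 1^2*b 3*a 2^2

/-- The quadratic invariant `I = I₂(fg)` of the product sextic of two binary cubics. -/
def Ic {A : Type*} [CommRing A] (a b : Fin 4 → A) : A :=
  228*a 0*b 0*a 3*b 3 - 52*a 1*b 0*a 3*b 2 - 24*a 1*b 0*a 2*b 3 - 24*a 0*b 1*a 3*b 2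
  - 52*a 0*b 1*a 2*b 3 + 4*a 2*b 0*a 3*b 1 + 16*a 2^2*b 0*b 2 + 16*a 1*b 1^2*a 3
  + 4*a 1*b 1*a 2*b 2 + 16*a 1^2*b 1*b 3 + 16*a 0*b 2^2*a 2 + 4*a 0*b 2*a 1*b 3
  - 6*a 3^2*b 0^2 - 6*a 2^2*b 1^2 - 6*a 1^2*b 2^2 - 6*a 0^2*b 3^2
/-- The coordinate ring of the space of pairs of binary cubics. -/
abbrev PairRing (k : Type*) [Field k] := MvPolynomial (Fin 4 ⊕ Fin 4) k

/-- The diagonal action of a `2×2` matrix on the coordinate ring of pairs of cubics. -/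
noncomputable def pairMatAct (k : Type*) [Field k] (g : Matrix (Fin 2) (Fin 2) k) :
    PairRing k →ₐ[k] PairRing k :=
  aeval (Sum.elim
    (actCoeff (PairRing k) 3 (g.map MvPolynomial.C) (fun i => X (Sum.inl i)))
    (actCoeff (PairRing k) 3 (g.map MvPolynomial.C) (fun i => X (Sum.inr i))))

/-- The action of the scaling `(f, g) ↦ (c f, c⁻¹ g)` on the coordinate ring. -/
noncomputable def pairScaleAct (k : Type*) [Field k] (c : kˣ) :
    PairRing k →ₐ[k] PairRing k :=
  aeval (Sum.elim (fun i => MvPolynomial.C (c : k) * X (Sum.inl i))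
    (fun i => MvPolynomial.C ((c⁻¹ : kˣ) : k) * X (Sum.inr i)))

/-- The action of the swap `(f, g) ↦ (g, f)` on the coordinate ring. -/
noncomputable def pairSwapAct (k : Type*) [Field k] :
    PairRing k →ₐ[k] PairRing k :=
  aeval (Sum.elim (fun i => X (Sum.inr i)) (fun i => X (Sum.inl i)))

/-- A rational function on the space of pairs of binary cubics is invariant under
`GL₂(k) × Γ`. -/
def PairRatInvariant (k : Type*) [Field k]
    (u : FractionRing (PairRing k)) : Prop :=
  (∀ g : GL (Fin 2) k, ∀ p q : PairRing k,
    u * algebraMap (PairRing k) (FractionRing (PairRing k)) q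
        = algebraMap (PairRing k) (FractionRing (PairRing k)) p →
    u * algebraMap (PairRing k) (FractionRing (PairRing k))
          (pairMatAct k (g : Matrix (Fin 2) (Fin 2) k) q)
        = algebraMap (PairRing k) (FractionRing (PairRing k))
          (pairMatAct k (g : Matrix (Fin 2) (Fin 2) k) p)) ∧
  (∀ c : kˣ, ∀ p q : PairRing k,
    u * algebraMap (PairRing k) (FractionRing (PairRing k)) q
        = algebraMap (PairRing k) (FractionRing (PairRing k)) p →
    u * algebraMap (PairRing k) (FractionRing (PairRing k)) (pairScaleAct k c q)
        = algebraMap (PairRing k) (FractionRing (PairRing k)) (pairScaleAct k c p)) ∧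
  (∀ p q : PairRing k,
    u * algebraMap (PairRing k) (FractionRing (PairRing k)) q
        = algebraMap (PairRing k) (FractionRing (PairRing k)) p →
    u * algebraMap (PairRing k) (FractionRing (PairRing k)) (pairSwapAct k q)
        = algebraMap (PairRing k) (FractionRing (PairRing k)) (pairSwapAct k p))


/-- Explicit form of the action on coefficient vectors of cubics. -/
def act3 {A : Type*} [CommRing A] (g : Matrix (Fin 2) (Fin 2) A) (a : Fin 4 → A) : Fin 4 → A :=
  ![a 0 * g 0 0 ^ 3 + a 1 * g 0 0 ^ 2 * g 1 0 + a 2 * g 0 0 * g 1 0 ^ 2 + a 3 * g 1 0 ^ 3,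
    3 * a 0 * g 0 0 ^ 2 * g 0 1 + a 1 * (2 * g 0 0 * g 0 1 * g 1 0 + g 0 0 ^ 2 * g 1 1)
      + a 2 * (g 0 1 * g 1 0 ^ 2 + 2 * g 0 0 * g 1 0 * g 1 1) + 3 * a 3 * g 1 0 ^ 2 * g 1 1,
    3 * a 0 * g 0 0 * g 0 1 ^ 2 + a 1 * (g 0 1 ^ 2 * g 1 0 + 2 * g 0 0 * g 0 1 * g 1 1)
      + a 2 * (2 * g 0 1 * g 1 0 * g 1 1 + g 0 0 * g 1 1 ^ 2) + 3 * a 3 * g 1 0 * g 1 1 ^ 2,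
    a 0 * g 0 1 ^ 3 + a 1 * g 0 1 ^ 2 * g 1 1 + a 2 * g 0 1 * g 1 1 ^ 2 + a 3 * g 1 1 ^ 3]

lemma formCoeff_toForm {A : Type*} [CommRing A] (a : Fin 4 → A) :
    formCoeff A 3 (toForm A 3 a) = a := by
  have key : ∀ i j : Fin 4, (Finsupp.single (0 : Fin 2) (3 - (j : ℕ)) + Finsupp.single 1 (j : ℕ) =
      Finsupp.single (0 : Fin 2) (3 - (i : ℕ)) + Finsupp.single 1 (i : ℕ)) ↔ j = i := by
    intro i j
    constructor
    · intro h
      have := DFunLike.congr_fun h 1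
      simp at this
      exact Fin.ext this
    · rintro rfl; rfl
  funext i
  have h : toForm A 3 a = ∑ j : Fin 4, monomial
      (Finsupp.single (0 : Fin 2) (3 - (j : ℕ)) + Finsupp.single 1 (j : ℕ)) (a j) := by
    unfold toForm
    refine Finset.sum_congr rfl fun j _ => ?_
    rw [X_pow_eq_monomial, X_pow_eq_monomial, C_mul_monomial, monomial_mul]
    simp
  unfold formCoeff
  rw [h, coeff_sum]
  simp only [coeff_monomial, key]
  simp

lemma actCoeff_eq {A : Type*} [CommRing A] (g : Matrix (Fin 2) (Fin 2) A) (a : Fin 4 → A) :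
    actCoeff A 3 g a = act3 g a := by
  have : matAct A g (toForm A 3 a) = toForm A 3 (act3 g a) := by
    unfold matAct toForm act3
    simp [Fin.sum_univ_four, map_ofNat]
    ring
  unfold actCoeff
  rw [this, formCoeff_toForm]

lemma act3_mul {A : Type*} [CommRing A] (g h : Matrix (Fin 2) (Fin 2) A) (a : Fin 4 → A) :
    act3 g (act3 h a) = act3 (h * g) a := by
  funext i
  fin_cases i <;> simp [act3, Matrix.mul_apply, Fin.sum_univ_two] <;> ring

lemma act3_one {A : Type*} [CommRing A] (a : Fin 4 → A) : act3 1 a = a := by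
  funext i
  fin_cases i <;> simp [act3]

lemma act3_smul {A : Type*} [CommRing A] (g : Matrix (Fin 2) (Fin 2) A) (c : A) (a : Fin 4 → A) :
    act3 g (c • a) = c • act3 g a := by
  funext i
  fin_cases i <;> simp [act3] <;> ring

lemma act3_map {A B : Type*} [CommRing A] [CommRing B] (f : A →+* B)
    (g : Matrix (Fin 2) (Fin 2) A) (a : Fin 4 → A) (i : Fin 4) :
    f (act3 g a i) = act3 (g.map f) (fun j => f (a j)) i := by
  fin_cases i <;> simp [act3, map_ofNat]

/-- First Hessian coefficient etc. -/
def hsA {A : Type*} [CommRing A] (a : Fin 4 → A) : A := a 1 ^ 2 - 3 * a 0 * a 2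
def hsB {A : Type*} [CommRing A] (a : Fin 4 → A) : A := a 1 * a 2 - 9 * a 0 * a 3
def hsC {A : Type*} [CommRing A] (a : Fin 4 → A) : A := a 2 ^ 2 - 3 * a 1 * a 3
def ln0 {A : Type*} [CommRing A] (a b : Fin 4 → A) : A :=
  hsA a * b 2 - hsB a * b 1 + 3 * hsC a * b 0
def ln1 {A : Type*} [CommRing A] (a b : Fin 4 → A) : A :=
  3 * hsA a * b 3 - hsB a * b 2 + hsC a * b 1
/-- The joint invariant of bidegree (6,2) separating the two cubics. -/
def Jc {A : Type*} [CommRing A] (a b : Fin 4 → A) : A :=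
  hsA a * ln1 a b ^ 2 - hsB a * ln0 a b * ln1 a b + hsC a * ln0 a b ^ 2

section maps
variable {A B : Type*} [CommRing A] [CommRing B] (f : A →+* B) (a b : Fin 4 → A)
lemma Hc_map : f (Hc a b) = Hc (fun i => f (a i)) (fun i => f (b i)) := by simp [Hc, map_ofNat]
lemma Ic_map : f (Ic a b) = Ic (fun i => f (a i)) (fun i => f (b i)) := by simp [Ic, map_ofNat]
lemma Rc_map : f (Rc a b) = Rc (fun i => f (a i)) (fun i => f (b i)) := by simp [Rc, map_ofNat]
lemma discCubic_map : f (discCubic a) = discCubic (fun i => f (a i)) := by simp [discCubic, map_ofNat]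
lemma Dc_map : f (Dc a b) = Dc (fun i => f (a i)) (fun i => f (b i)) := by
  simp [Dc, discCubic_map]
lemma hsA_map : f (hsA a) = hsA (fun i => f (a i)) := by simp [hsA, map_ofNat]
lemma Jc_map : f (Jc a b) = Jc (fun i => f (a i)) (fun i => f (b i)) := by
  simp [Jc, hsA, hsB, hsC, ln0, ln1, map_ofNat]
end maps

section scale
variable {A : Type*} [CommRing A] (c d : A) (a b : Fin 4 → A)
lemma Hc_scale (h : c * d = 1) : Hc (c • a) (d • b) = Hc a b := by
  have : Hc (c • a) (d • b) = (c * d) * Hc a b := by simp [Hc]; ring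
  rw [this, h]; ring
lemma Ic_scale (h : c * d = 1) : Ic (c • a) (d • b) = Ic a b := by
  have : Ic (c • a) (d • b) = (c * d) ^ 2 * Ic a b := by simp [Ic]; ring
  rw [this, h]; ring
lemma Rc_scale (h : c * d = 1) : Rc (c • a) (d • b) = Rc a b := by
  have : Rc (c • a) (d • b) = (c * d) ^ 3 * Rc a b := by simp [Rc]; ring
  rw [this, h]; ring
lemma Dc_scale (h : c * d = 1) : Dc (c • a) (d • b) = Dc a b := by
  have : Dc (c • a) (d • b) = (c * d) ^ 4 * Dc a b := by simp [Dc, discCubic]; ring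
  rw [this, h]; ring
lemma discCubic_scale : discCubic (c • a) = c ^ 4 * discCubic a := by simp [discCubic]; ring
lemma Jc_scale (h : c * d = 1) : Jc (c • a) (d • b) = c ^ 4 * Jc a b := by
  have : Jc (c • a) (d • b) = c ^ 4 * (c * d) ^ 2 * Jc a b := by
    have e0 : ln0 (c • a) (d • b) = c * (c * d) * ln0 a b := by simp [ln0, hsA, hsB, hsC]; ring
    have e1 : ln1 (c • a) (d • b) = c * (c * d) * ln1 a b := by simp [ln1, hsA, hsB, hsC]; ring
    have eA : hsA (c • a) = c ^ 2 * hsA a := by simp [hsA]; ring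
    have eB : hsB (c • a) = c ^ 2 * hsB a := by simp [hsB]; ring
    have eC : hsC (c • a) = c ^ 2 * hsC a := by simp [hsC]; ring
    simp only [Jc, e0, e1, eA, eB, eC]; ring
  rw [this, h]; ring
end scale

section swap
variable {A : Type*} [CommRing A] (a b : Fin 4 → A)
lemma Hc_swap : Hc b a = - Hc a b := by simp [Hc]; ring
lemma Ic_swap : Ic b a = Ic a b := by simp [Ic]; ring
lemma Rc_swap : Rc b a = - Rc a b := by simp [Rc]; ring
lemma Dc_swap : Dc b a = Dc a b := by simp [Dc]; ring
end swap


/-- Covariance of weight `w` under invertible matrices follows from that under diagonal and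
unipotent matrices. -/
lemma cov_of_gen {k A : Type*} [Field k] [CommRing A] (f : k →+* A)
    (Φ : (Fin 4 → A) → (Fin 4 → A) → A) (w : ℕ)
    (hd : ∀ (p q : A) (a b : Fin 4 → A),
      Φ (act3 !![p, 0; 0, q] a) (act3 !![p, 0; 0, q] b) = (p * q) ^ w * Φ a b)
    (hu : ∀ (c : A) (a b : Fin 4 → A),
      Φ (act3 !![1, c; 0, 1] a) (act3 !![1, c; 0, 1] b) = Φ a b)
    (hl : ∀ (c : A) (a b : Fin 4 → A),
      Φ (act3 !![1, 0; c, 1] a) (act3 !![1, 0; c, 1] b) = Φ a b)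
    (g : Matrix (Fin 2) (Fin 2) k) (hg : g.det ≠ 0) (a b : Fin 4 → A) :
    Φ (act3 (g.map f) a) (act3 (g.map f) b) = f g.det ^ w * Φ a b := by
  revert a b
  refine Matrix.diagonal_transvection_induction_of_det_ne_zero
    (fun g => ∀ a b, Φ (act3 (g.map f) a) (act3 (g.map f) b) = f g.det ^ w * Φ a b) g hg ?_ ?_ ?_
  · intro D _ a b
    have : (Matrix.diagonal D).map f = !![f (D 0), 0; 0, f (D 1)] := by
      ext i j; fin_cases i <;> fin_cases j <;> simp
    rw [this, hd]
    simp [Matrix.det_fin_two]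
  · intro t a b
    obtain ⟨i, j, hij, c⟩ := t
    fin_cases i <;> fin_cases j
    · exact absurd rfl hij
    · have : (Matrix.TransvectionStruct.toMatrix ⟨(0 : Fin 2), 1, hij, c⟩).map f
          = !![1, f c; 0, 1] := by
        ext i j
        fin_cases i <;> fin_cases j <;>
          simp [Matrix.TransvectionStruct.toMatrix, Matrix.transvection, Matrix.single]
      have h2 := hu (f c) a b
      rw [← this] at h2
      have h3 := Matrix.TransvectionStruct.det ⟨(0 : Fin 2), 1, hij, c⟩
      simp only [Fin.zero_eta, Fin.mk_one] at *
      rw [h2, h3]; simp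
    · have : (Matrix.TransvectionStruct.toMatrix ⟨(1 : Fin 2), 0, hij, c⟩).map f
          = !![1, 0; f c, 1] := by
        ext i j
        fin_cases i <;> fin_cases j <;>
          simp [Matrix.TransvectionStruct.toMatrix, Matrix.transvection, Matrix.single]
      have h2 := hl (f c) a b
      rw [← this] at h2
      have h3 := Matrix.TransvectionStruct.det ⟨(1 : Fin 2), 0, hij, c⟩
      simp only [Fin.zero_eta, Fin.mk_one] at *
      rw [h2, h3]; simp
    · exact absurd rfl hij
  · intro M N _ _ hM hN a b
    have : (M * N).map f = M.map f * N.map f := Matrix.map_mul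
    rw [this, ← act3_mul, ← act3_mul, hN, hM, Matrix.det_mul, map_mul]
    ring

section
variable {A : Type*} [CommRing A] (a : Fin 4 → A)
lemma act3_diag (p q : A) : act3 !![p, 0; 0, q] a =
    ![a 0 * p ^ 3, a 1 * p ^ 2 * q, a 2 * p * q ^ 2, a 3 * q ^ 3] := by
  funext i; fin_cases i <;> simp [act3] <;> ring
lemma act3_up (c : A) : act3 !![1, c; 0, 1] a =
    ![a 0, a 1 + 3 * c * a 0, a 2 + 2 * c * a 1 + 3 * c ^ 2 * a 0,
      a 3 + c * a 2 + c ^ 2 * a 1 + c ^ 3 * a 0] := by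
  funext i; fin_cases i <;> simp [act3] <;> ring
lemma act3_lo (c : A) : act3 !![1, 0; c, 1] a =
    ![a 0 + c * a 1 + c ^ 2 * a 2 + c ^ 3 * a 3, a 1 + 2 * c * a 2 + 3 * c ^ 2 * a 3,
      a 2 + 3 * c * a 3, a 3] := by
  funext i; fin_cases i <;> simp [act3] <;> ring
end

section
variable {k A : Type*} [Field k] [CommRing A] (f : k →+* A)
  (g : Matrix (Fin 2) (Fin 2) k) (hg : g.det ≠ 0) (a b : Fin 4 → A)

lemma vec4 (x y z w : A) : (![x, y, z, w] 0 = x ∧ ![x, y, z, w] 1 = y) ∧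
    (![x, y, z, w] 2 = z ∧ ![x, y, z, w] 3 = w) := by simp

theorem Hc_cov (hg : g.det ≠ 0) : Hc (act3 (g.map f) a) (act3 (g.map f) b) = f g.det ^ 3 * Hc a b := by
  refine cov_of_gen f Hc 3 ?_ ?_ ?_ g hg a b
  · intro p q a b; rw [act3_diag, act3_diag]; simp only [Hc, vec4]; ring
  · intro c a b; rw [act3_up, act3_up]; simp only [Hc, vec4]; ring
  · intro c a b; rw [act3_lo, act3_lo]; simp only [Hc, vec4]; ring

theorem disc_cov (hg : g.det ≠ 0) : discCubic (act3 (g.map f) a) = f g.det ^ 6 * discCubic a := by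
  refine cov_of_gen f (fun a _ => discCubic a) 6 ?_ ?_ ?_ g hg a a
  · intro p q a b; simp only [act3_diag, discCubic, vec4]; ring
  · intro c a b; simp only [act3_up, discCubic, vec4]; ring
  · intro c a b; simp only [act3_lo, discCubic, vec4]; ring

theorem Dc_cov (hg : g.det ≠ 0) : Dc (act3 (g.map f) a) (act3 (g.map f) b) = f g.det ^ 12 * Dc a b := by
  simp only [Dc, disc_cov f g _ hg]; ring

theorem Ic_cov (hg : g.det ≠ 0) : Ic (act3 (g.map f) a) (act3 (g.map f) b) = f g.det ^ 6 * Ic a b := by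
  refine cov_of_gen f Ic 6 ?_ ?_ ?_ g hg a b
  · intro p q a b; rw [act3_diag, act3_diag]; simp only [Ic, vec4]; ring
  · intro c a b; rw [act3_up, act3_up]; simp only [Ic, vec4]; ring
  · intro c a b; rw [act3_lo, act3_lo]; simp only [Ic, vec4]; ring

theorem Jc_cov (hg : g.det ≠ 0) : Jc (act3 (g.map f) a) (act3 (g.map f) b) = f g.det ^ 12 * Jc a b := by
  refine cov_of_gen f Jc 12 ?_ ?_ ?_ g hg a b
  · intro p q a b; rw [act3_diag, act3_diag]; simp only [Jc, hsA, hsB, hsC, ln0, ln1, vec4]; ring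
  · intro c a b; rw [act3_up, act3_up]
    have eA : hsA ![a 0, a 1 + 3 * c * a 0, a 2 + 2 * c * a 1 + 3 * c ^ 2 * a 0,
      a 3 + c * a 2 + c ^ 2 * a 1 + c ^ 3 * a 0] = hsA a := by simp only [hsA, vec4]; ring
    have eB : hsB ![a 0, a 1 + 3 * c * a 0, a 2 + 2 * c * a 1 + 3 * c ^ 2 * a 0,
      a 3 + c * a 2 + c ^ 2 * a 1 + c ^ 3 * a 0] = hsB a + 2 * c * hsA a := by
      simp only [hsA, hsB, vec4]; ring
    have eC : hsC ![a 0, a 1 + 3 * c * a 0, a 2 + 2 * c * a 1 + 3 * c ^ 2 * a 0,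
      a 3 + c * a 2 + c ^ 2 * a 1 + c ^ 3 * a 0] = hsC a + c * hsB a + c ^ 2 * hsA a := by
      simp only [hsA, hsB, hsC, vec4]; ring
    simp only [Jc, ln0, ln1, eA, eB, eC, vec4]; ring
  · intro c a b; rw [act3_lo, act3_lo]
    have eA : hsA ![a 0 + c * a 1 + c ^ 2 * a 2 + c ^ 3 * a 3, a 1 + 2 * c * a 2 + 3 * c ^ 2 * a 3,
      a 2 + 3 * c * a 3, a 3] = hsA a + c * hsB a + c ^ 2 * hsC a := by
      simp only [hsA, hsB, hsC, vec4]; ring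
    have eB : hsB ![a 0 + c * a 1 + c ^ 2 * a 2 + c ^ 3 * a 3, a 1 + 2 * c * a 2 + 3 * c ^ 2 * a 3,
      a 2 + 3 * c * a 3, a 3] = hsB a + 2 * c * hsC a := by simp only [hsB, hsC, vec4]; ring
    have eC : hsC ![a 0 + c * a 1 + c ^ 2 * a 2 + c ^ 3 * a 3, a 1 + 2 * c * a 2 + 3 * c ^ 2 * a 3,
      a 2 + 3 * c * a 3, a 3] = hsC a := by simp only [hsC, vec4]; ring
    simp only [Jc, ln0, ln1, eA, eB, eC, vec4]; ring

set_option maxHeartbeats 4000000 in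
theorem Rc_cov (hg : g.det ≠ 0) : Rc (act3 (g.map f) a) (act3 (g.map f) b) = f g.det ^ 9 * Rc a b := by
  refine cov_of_gen f Rc 9 ?_ ?_ ?_ g hg a b
  · intro p q a b; rw [act3_diag, act3_diag]; simp only [Rc, vec4]; ring
  · intro c a b; rw [act3_up, act3_up]; simp only [Rc, vec4]; ring
  · intro c a b; rw [act3_lo, act3_lo]; simp only [Rc, vec4]; ring
end


/-- The fixed field of an endomorphism. -/
def fixIF {k E : Type*} [Field k] [Field E] [Algebra k E] (σ : E →ₐ[k] E) :
    IntermediateField k E where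
  carrier := {x | σ x = x}
  mul_mem' := fun {a b} ha hb => by
    simp only [Set.mem_setOf_eq] at *; rw [map_mul, ha, hb]
  add_mem' := fun {a b} ha hb => by
    simp only [Set.mem_setOf_eq] at *; rw [map_add, ha, hb]
  algebraMap_mem' := fun r => by simp
  inv_mem' := fun a ha => by
    simp only [Set.mem_setOf_eq] at *; rw [map_inv₀, ha]

lemma mem_fixIF {k E : Type*} [Field k] [Field E] [Algebra k E] (σ : E →ₐ[k] E) (x : E) :
    x ∈ fixIF σ ↔ σ x = x := Iff.rfl

section ext
variable {k A : Type*} [Field k] [CommRing A] [IsDomain A] [Algebra k A]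

lemma comp_inj (θ : A →ₐ[k] A) (hθ : Function.Injective θ) : Function.Injective
    ((IsScalarTower.toAlgHom k A (FractionRing A)).comp θ) :=
  (IsFractionRing.injective A (FractionRing A)).comp hθ

/-- Extension of an injective endomorphism to the fraction field. -/
def extF (θ : A →ₐ[k] A) (hθ : Function.Injective θ) :
    FractionRing A →ₐ[k] FractionRing A :=
  IsFractionRing.liftAlgHom (comp_inj θ hθ)

lemma extF_algebraMap (θ : A →ₐ[k] A) (hθ : Function.Injective θ) (p : A) :
    extF θ hθ (algebraMap A (FractionRing A) p) = algebraMap A (FractionRing A) (θ p) := by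
  unfold extF
  rw [IsFractionRing.liftAlgHom_apply, IsFractionRing.lift_algebraMap]
  rfl

lemma extF_iff (θ : A →ₐ[k] A) (hθ : Function.Injective θ) (u : FractionRing A) :
    (∀ p q : A, u * algebraMap A (FractionRing A) q = algebraMap A (FractionRing A) p →
      u * algebraMap A (FractionRing A) (θ q) = algebraMap A (FractionRing A) (θ p)) ↔
    extF θ hθ u = u := by
  constructor
  · intro h
    obtain ⟨p, q, hq, rfl⟩ := IsFractionRing.div_surjective A u
    have hq0 : algebraMap A (FractionRing A) q ≠ 0 := by
      simpa using nonZeroDivisors.ne_zero hq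
    have hq1 : algebraMap A (FractionRing A) (θ q) ≠ 0 := by
      have : θ q ≠ 0 := fun h0 => nonZeroDivisors.ne_zero hq (hθ (by simpa using h0))
      simpa using this
    have := h p q (by field_simp)
    rw [map_div₀, extF_algebraMap, extF_algebraMap, ← this]
    field_simp
  · intro h p q hpq
    have := congrArg (extF θ hθ) hpq
    rwa [map_mul, extF_algebraMap, extF_algebraMap, h] at this
end ext

section res
variable {k A S : Type*} [Field k] [CommRing A] [IsDomain A] [Algebra k A]
  [CommRing S] [IsDomain S] [Algebra k S]

/-- `e` is the restriction of the rational function `u` along `ρ`. -/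
def Res (ρ : A →ₐ[k] S) (u : FractionRing A) (e : FractionRing S) : Prop :=
  ∃ p q : A, ρ q ≠ 0 ∧ u * algebraMap A (FractionRing A) q = algebraMap A (FractionRing A) p ∧
    e * algebraMap S (FractionRing S) (ρ q) = algebraMap S (FractionRing S) (ρ p)

variable {ρ : A →ₐ[k] S}

lemma aM_ne {S : Type*} [CommRing S] [IsDomain S] {s : S} (h : s ≠ 0) :
    algebraMap S (FractionRing S) s ≠ 0 := by simpa using h

lemma Res.poly (p : A) : Res ρ (algebraMap A (FractionRing A) p)
    (algebraMap S (FractionRing S) (ρ p)) := ⟨p, 1, by simp, by simp, by simp⟩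

lemma Res.const (c : k) : Res ρ (algebraMap k (FractionRing A) c)
    (algebraMap k (FractionRing S) c) := by
  have := Res.poly (ρ := ρ) (algebraMap k A c)
  rwa [AlgHom.commutes, ← IsScalarTower.algebraMap_apply, ← IsScalarTower.algebraMap_apply] at this

lemma Res.unique {u : FractionRing A} {e e' : FractionRing S} (h : Res ρ u e) (h' : Res ρ u e') :
    e = e' := by
  obtain ⟨p, q, hq, h1, h2⟩ := h
  obtain ⟨p', q', hq', h1', h2'⟩ := h'
  have key : p * q' = p' * q := by
    apply IsFractionRing.injective A (FractionRing A)
    rw [map_mul, map_mul, ← h1, ← h1']; ring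
  have key2 : ρ p * ρ q' = ρ p' * ρ q := by rw [← map_mul, key, map_mul]
  have key3 := congrArg (algebraMap S (FractionRing S)) key2
  rw [map_mul, map_mul, ← h2, ← h2'] at key3
  have a1 := aM_ne hq
  have a2 := aM_ne hq'
  have : (e - e') * (algebraMap S (FractionRing S) (ρ q) * algebraMap S (FractionRing S) (ρ q')) = 0 := by
    linear_combination key3
  rcases mul_eq_zero.1 this with h | h
  · exact sub_eq_zero.1 h
  · exact absurd h (mul_ne_zero a1 a2)

lemma Res.add {u u' : FractionRing A} {e e' : FractionRing S} (h : Res ρ u e) (h' : Res ρ u' e') :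
    Res ρ (u + u') (e + e') := by
  obtain ⟨p, q, hq, h1, h2⟩ := h
  obtain ⟨p', q', hq', h1', h2'⟩ := h'
  refine ⟨p * q' + p' * q, q * q', by simp [hq, hq'], ?_, ?_⟩
  · simp only [map_mul, map_add, ← h1, ← h1']; ring
  · simp only [map_mul, map_add, ← h2, ← h2']; ring

lemma Res.mul {u u' : FractionRing A} {e e' : FractionRing S} (h : Res ρ u e) (h' : Res ρ u' e') :
    Res ρ (u * u') (e * e') := by
  obtain ⟨p, q, hq, h1, h2⟩ := h
  obtain ⟨p', q', hq', h1', h2'⟩ := h'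
  refine ⟨p * p', q * q', by simp [hq, hq'], ?_, ?_⟩
  · simp only [map_mul, ← h1, ← h1']; ring
  · simp only [map_mul, ← h2, ← h2']; ring

lemma Res.inv {u : FractionRing A} {e : FractionRing S} (h : Res ρ u e) (he : e ≠ 0) :
    Res ρ u⁻¹ e⁻¹ := by
  obtain ⟨p, q, hq, h1, h2⟩ := h
  have hp : ρ p ≠ 0 := by
    intro h0
    rw [h0, map_zero] at h2
    exact mul_ne_zero he (aM_ne hq) h2
  have hu : u ≠ 0 := by
    rintro rfl
    rw [zero_mul] at h1
    have : p = 0 := by simpa using h1.symm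
    exact hp (by rw [this, map_zero])
  refine ⟨q, p, hp, ?_, ?_⟩
  · rw [← h1]; field_simp
  · rw [← h2]; field_simp

lemma Res.neg {u : FractionRing A} {e : FractionRing S} (h : Res ρ u e) : Res ρ (-u) (-e) := by
  have := (Res.const (ρ := ρ) (-1)).mul h
  simpa using this

lemma Res.sub {u u' : FractionRing A} {e e' : FractionRing S} (h : Res ρ u e) (h' : Res ρ u' e') :
    Res ρ (u - u') (e - e') := by
  rw [sub_eq_add_neg, sub_eq_add_neg]; exact h.add h'.neg

lemma Res.div {u u' : FractionRing A} {e e' : FractionRing S} (h : Res ρ u e) (h' : Res ρ u' e')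
    (he : e' ≠ 0) : Res ρ (u / u') (e / e') := by
  rw [div_eq_mul_inv, div_eq_mul_inv]; exact h.mul (h'.inv he)

lemma Res.pow {u : FractionRing A} {e : FractionRing S} (h : Res ρ u e) (n : ℕ) :
    Res ρ (u ^ n) (e ^ n) := by
  induction n with
  | zero => simpa using Res.const (ρ := ρ) 1
  | succ n ih => rw [pow_succ, pow_succ]; exact ih.mul h

lemma Res.extF {u : FractionRing A} {e : FractionRing S} (h : Res ρ u e)
    (θ : A →ₐ[k] A) (hθ : Function.Injective θ) (σ : S →ₐ[k] S) (hσ : Function.Injective σ)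
    (hc : ∀ p, ρ (θ p) = σ (ρ p)) : Res ρ (extF θ hθ u) (extF σ hσ e) := by
  obtain ⟨p, q, hq, h1, h2⟩ := h
  refine ⟨θ p, θ q, ?_, ?_, ?_⟩
  · rw [hc]; intro h0; exact hq (hσ (by simpa using h0))
  · rw [← extF_algebraMap θ hθ, ← extF_algebraMap θ hθ, ← map_mul, h1]
  · rw [hc, hc, ← extF_algebraMap σ hσ, ← extF_algebraMap σ hσ, ← map_mul, h2]

/-- If generators of `S`-side field lift to `K`, everything in the adjoined field lifts. -/
lemma Res.adjoin (K : IntermediateField k (FractionRing A)) (T : Set (FractionRing S))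
    (hT : ∀ t ∈ T, ∃ w ∈ K, Res ρ w t) (e : FractionRing S)
    (he : e ∈ IntermediateField.adjoin k T) : ∃ w ∈ K, Res ρ w e := by
  induction he using IntermediateField.adjoin_induction with
  | mem x hx => exact hT x hx
  | algebraMap x => exact ⟨_, K.algebraMap_mem x, Res.const x⟩
  | add x y _ _ hx hy =>
    obtain ⟨a, ha, ha'⟩ := hx
    obtain ⟨b, hb, hb'⟩ := hy
    exact ⟨a + b, K.add_mem ha hb, ha'.add hb'⟩
  | mul x y _ _ hx hy =>
    obtain ⟨a, ha, ha'⟩ := hx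
    obtain ⟨b, hb, hb'⟩ := hy
    exact ⟨a * b, K.mul_mem ha hb, ha'.mul hb'⟩
  | inv x _ hx =>
    obtain ⟨a, ha, ha'⟩ := hx
    by_cases h0 : x = 0
    · subst h0
      exact ⟨0, K.zero_mem, by simpa using Res.const (ρ := ρ) 0⟩
    · exact ⟨a⁻¹, K.inv_mem ha, ha'.inv h0⟩
end res


/-- The first cubic `X³ + Y³` of the slice. -/
def sliceA {A : Type*} [CommRing A] : Fin 4 → A := ![1, 0, 0, 1]
/-- The second cubic of the slice. -/
def sliceB {A : Type*} [CommRing A] (v : Fin 3 → A) : Fin 4 → A := ![v 0, v 1, v 2, v 0 + 1]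

lemma act3_smul_mat {A : Type*} [CommRing A] (g : Matrix (Fin 2) (Fin 2) A) (c : A)
    (a : Fin 4 → A) : act3 (c • g) a = c ^ 3 • act3 g a := by
  funext i
  fin_cases i <;> simp [act3] <;> ring

lemma cubic_normal {k : Type*} [Field k] [IsAlgClosed k] (h2 : (2 : k) ≠ 0) (h3 : (3 : k) ≠ 0)
    (a : Fin 4 → k) (hA : hsA a ≠ 0) (hD : discCubic a ≠ 0) :
    ∃ G : Matrix (Fin 2) (Fin 2) k, G.det ≠ 0 ∧ act3 G sliceA = a := by
  obtain ⟨r, hr⟩ := IsAlgClosed.exists_eq_mul_self (hsB a ^ 2 - 4 * hsA a * hsC a)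
  have hdisc : hsB a ^ 2 - 4 * hsA a * hsC a = -3 * discCubic a := by
    simp only [hsA, hsB, hsC, discCubic]; ring
  have hr0 : r ≠ 0 := by
    rintro rfl
    rw [hdisc] at hr
    have : (3 : k) * discCubic a = 0 := by linear_combination -hr
    exact mul_ne_zero h3 hD this
  obtain ⟨t1, ht1⟩ : ∃ t, t = (-hsB a + r) / (2 * hsA a) := ⟨_, rfl⟩
  obtain ⟨t2, ht2⟩ : ∃ t, t = (-hsB a - r) / (2 * hsA a) := ⟨_, rfl⟩
  have e1 : 2 * hsA a * t1 = -hsB a + r := by rw [ht1]; field_simp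
  have e2 : 2 * hsA a * t2 = -hsB a - r := by rw [ht2]; field_simp
  have h12 : t1 - t2 ≠ 0 := by
    intro h
    have : 2 * r = 0 := by linear_combination 2 * hsA a * h - e1 + e2
    exact mul_ne_zero h2 hr0 this
  have q1 : hsA a * t1 ^ 2 + hsB a * t1 + hsC a = 0 := by
    have h4 : (4 * hsA a) ≠ 0 := by
      have : (4 : k) = 2 * 2 := by norm_num
      rw [this]; exact mul_ne_zero (mul_ne_zero h2 h2) hA
    apply mul_left_cancel₀ h4
    linear_combination (2 * hsA a * t1 + hsB a + r) * e1 - hr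
  have q2 : hsA a * t2 ^ 2 + hsB a * t2 + hsC a = 0 := by
    have h4 : (4 * hsA a) ≠ 0 := by
      have : (4 : k) = 2 * 2 := by norm_num
      rw [this]; exact mul_ne_zero (mul_ne_zero h2 h2) hA
    apply mul_left_cancel₀ h4
    linear_combination (2 * hsA a * t2 + hsB a - r) * e2 - hr
  clear ht1 ht2 e1 e2
  obtain ⟨α, hα⟩ : ∃ t, t = (-a 1 / 3 - a 0 * t2) / (t1 - t2) := ⟨_, rfl⟩
  obtain ⟨β, hβ⟩ : ∃ t, t = a 0 - α := ⟨_, rfl⟩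
  have f0 : α + β = a 0 := by rw [hβ]; ring
  have f1 : -3 * (α * t1 + β * t2) = a 1 := by
    have : α * (t1 - t2) = -a 1 / 3 - a 0 * t2 := by rw [hα]; field_simp
    have h : 3 * (α * (t1 - t2)) = -a 1 - 3 * a 0 * t2 := by rw [this]; field_simp
    linear_combination -h - 3 * t2 * f0
  clear hα hβ
  have f2 : 3 * (α * t1 ^ 2 + β * t2 ^ 2) = a 2 := by
    apply mul_left_cancel₀ hA
    have : hsA a * a 2 - hsB a * a 1 + 3 * hsC a * a 0 = 0 := by
      simp only [hsA, hsB, hsC]; ring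
    linear_combination 3 * α * q1 + 3 * β * q2 - 3 * hsC a * f0 + hsB a * f1 - this
  have f3 : -(α * t1 ^ 3 + β * t2 ^ 3) = a 3 := by
    apply mul_left_cancel₀ (mul_ne_zero h3 hA)
    have : 3 * hsA a * a 3 - hsB a * a 2 + hsC a * a 1 = 0 := by
      simp only [hsA, hsB, hsC]; ring
    linear_combination -3 * α * t1 * q1 - 3 * β * t2 * q2 + hsB a * f2 - hsC a * f1 - this
  have hαβ : hsA a = -9 * (α * β) * (t1 - t2) ^ 2 := by
    simp only [hsA, ← f0, ← f1, ← f2]; ring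
  have hα0 : α ≠ 0 := by rintro rfl; exact hA (by rw [hαβ]; ring)
  have hβ0 : β ≠ 0 := by rintro rfl; exact hA (by rw [hαβ]; ring)
  obtain ⟨p, hp⟩ := IsAlgClosed.exists_pow_nat_eq α (n := 3) (by norm_num)
  obtain ⟨q, hq⟩ := IsAlgClosed.exists_pow_nat_eq β (n := 3) (by norm_num)
  have hp0 : p ≠ 0 := by rintro rfl; exact hα0 (by rw [← hp]; ring)
  have hq0 : q ≠ 0 := by rintro rfl; exact hβ0 (by rw [← hq]; ring)
  refine ⟨!![p, -p * t1; q, -q * t2], ?_, ?_⟩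
  · rw [Matrix.det_fin_two_of]
    have : p * (-q * t2) - -p * t1 * q = p * q * (t1 - t2) := by ring
    rw [this]
    exact mul_ne_zero (mul_ne_zero hp0 hq0) h12
  · funext i
    fin_cases i
    · simp [act3, sliceA]; rw [← f0, ← hp, ← hq]
    · simp [act3, sliceA]; rw [← f1, ← hp, ← hq]; ring
    · simp [act3, sliceA]; rw [← f2, ← hp, ← hq]; ring
    · simp [act3, sliceA]; rw [← f3, ← hp, ← hq]; ring

lemma pair_normal {k : Type*} [Field k] [IsAlgClosed k] (h2 : (2 : k) ≠ 0) (h3 : (3 : k) ≠ 0)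
    (a b : Fin 4 → k) (hA : hsA a ≠ 0) (hD : discCubic a ≠ 0) (hH : Hc a b ≠ 0) :
    ∃ (g : GL (Fin 2) k) (c : kˣ) (v : Fin 3 → k),
      act3 (g : Matrix (Fin 2) (Fin 2) k) ((c : k) • sliceA) = a ∧
      act3 (g : Matrix (Fin 2) (Fin 2) k) (((c⁻¹ : kˣ) : k) • sliceB v) = b := by
  obtain ⟨G, hG, ha⟩ := cubic_normal h2 h3 a hA hD
  obtain ⟨b', hb'⟩ : ∃ b', act3 G b' = b := by
    refine ⟨act3 G⁻¹ b, ?_⟩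
    rw [act3_mul, Matrix.nonsing_inv_mul _ (isUnit_iff_ne_zero.2 hG), act3_one]
  have hh : b' 3 - b' 0 ≠ 0 := by
    intro h0
    have := Hc_cov (RingHom.id k) G sliceA b' hG
    simp only [RingHom.id_apply] at this
    have hid2 : G.map (RingHom.id k) = G := by ext; simp
    simp only [hid2, ha, hb'] at this
    apply hH
    rw [this]
    simp only [Hc, sliceA, vec4]
    linear_combination (3 * G.det ^ 3) * h0
  obtain ⟨l, hl⟩ := IsAlgClosed.exists_pow_nat_eq (b' 3 - b' 0) (n := 6) (by norm_num)
  have hl0 : l ≠ 0 := by rintro rfl; exact hh (by rw [← hl]; ring)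
  have hdet : (l • G).det ≠ 0 := by
    rw [Matrix.det_smul]; exact mul_ne_zero (pow_ne_zero _ hl0) hG
  refine ⟨Matrix.GeneralLinearGroup.mkOfDetNeZero (l • G) hdet, (Units.mk0 (l ^ 3) (pow_ne_zero _ hl0))⁻¹,
    ![b' 0 / (b' 3 - b' 0), b' 1 / (b' 3 - b' 0), b' 2 / (b' 3 - b' 0)], ?_, ?_⟩
  · change act3 (l • G) _ = a
    rw [act3_smul_mat, act3_smul, ha, smul_smul]
    simp [hl0]
  · change act3 (l • G) _ = b
    rw [act3_smul_mat, ← act3_smul, smul_smul, ← hb']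
    congr 1
    have : l ^ 3 * ↑(((Units.mk0 (l ^ 3) (pow_ne_zero _ hl0))⁻¹)⁻¹ : kˣ) = b' 3 - b' 0 := by
      rw [← hl]; simp; ring
    rw [this]
    funext i
    fin_cases i <;> simp [sliceB] <;> field_simp
    ring

section
variable {k : Type*} [Field k]

lemma aeval_mat {B : Type*} [CommRing B] [Algebra k B] (a b : Fin 4 → B)
    (g : Matrix (Fin 2) (Fin 2) k) (p : PairRing k) :
    aeval (Sum.elim a b) (pairMatAct k g p) =
      aeval (Sum.elim (act3 (g.map (algebraMap k B)) a) (act3 (g.map (algebraMap k B)) b)) p := by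
  have : (aeval (Sum.elim a b)).comp (pairMatAct k g) =
      (aeval (Sum.elim (act3 (g.map (algebraMap k B)) a) (act3 (g.map (algebraMap k B)) b)) :
        PairRing k →ₐ[k] B) := by
    have hm : (g.map (C : k →+* PairRing k)).map (aeval (R := k) (Sum.elim a b)).toRingHom
        = g.map (algebraMap k B) := by
      ext i j; simp
    apply MvPolynomial.algHom_ext
    rintro (i | i)
    · simp only [pairMatAct, AlgHom.comp_apply, aeval_X, Sum.elim_inl, actCoeff_eq]
      have := act3_map (aeval (R := k) (Sum.elim a b)).toRingHom (g.map (C : k →+* PairRing k))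
        (fun i => X (Sum.inl i)) i
      rw [hm] at this
      refine this.trans ?_
      congr 1; funext j; simp
    · simp only [pairMatAct, AlgHom.comp_apply, aeval_X, Sum.elim_inr, actCoeff_eq]
      have := act3_map (aeval (R := k) (Sum.elim a b)).toRingHom (g.map (C : k →+* PairRing k))
        (fun i => X (Sum.inr i)) i
      rw [hm] at this
      refine this.trans ?_
      congr 1; funext j; simp
  exact DFunLike.congr_fun this p

lemma aeval_scale {B : Type*} [CommRing B] [Algebra k B] (a b : Fin 4 → B)
    (c : kˣ) (p : PairRing k) :
    aeval (Sum.elim a b) (pairScaleAct k c p) =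
      aeval (Sum.elim (algebraMap k B c • a) (algebraMap k B ((c⁻¹ : kˣ) : k) • b)) p := by
  have : (aeval (Sum.elim a b)).comp (pairScaleAct k c) =
      (aeval (Sum.elim (algebraMap k B c • a) (algebraMap k B ((c⁻¹ : kˣ) : k) • b)) :
        PairRing k →ₐ[k] B) := by
    apply MvPolynomial.algHom_ext
    rintro (i | i) <;> simp [pairScaleAct, Algebra.smul_def]
  exact DFunLike.congr_fun this p

lemma aeval_swap {B : Type*} [CommRing B] [Algebra k B] (a b : Fin 4 → B) (p : PairRing k) :
    aeval (Sum.elim a b) (pairSwapAct k p) = aeval (Sum.elim b a) p := by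
  have : (aeval (Sum.elim a b)).comp (pairSwapAct k) =
      (aeval (Sum.elim b a) : PairRing k →ₐ[k] B) := by
    apply MvPolynomial.algHom_ext
    rintro (i | i) <;> simp [pairSwapAct]
  exact DFunLike.congr_fun this p

/-- Generic vectors. -/
def gA : Fin 4 → PairRing k := fun i => X (Sum.inl i)
def gB : Fin 4 → PairRing k := fun i => X (Sum.inr i)

lemma aeval_gen (p : PairRing k) : aeval (Sum.elim gA gB) p = p := by
  have : (Sum.elim gA gB : Fin 4 ⊕ Fin 4 → PairRing k) = X := by
    funext i; rcases i with i | i <;> rfl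
  rw [this, aeval_X_left]; rfl

lemma mat_eq (g : Matrix (Fin 2) (Fin 2) k) (p : PairRing k) : pairMatAct k g p =
    aeval (Sum.elim (act3 (g.map (algebraMap k (PairRing k))) gA)
      (act3 (g.map (algebraMap k (PairRing k))) gB)) p := by
  rw [← aeval_mat, aeval_gen]
lemma scale_eq (c : kˣ) (p : PairRing k) : pairScaleAct k c p =
    aeval (Sum.elim (algebraMap k (PairRing k) c • gA)
      (algebraMap k (PairRing k) ((c⁻¹ : kˣ) : k) • gB)) p := by
  rw [← aeval_scale, aeval_gen]
lemma swap_eq (p : PairRing k) : pairSwapAct k p = aeval (Sum.elim gB gA) p := by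
  rw [← aeval_swap, aeval_gen]

lemma mat_inj (g : GL (Fin 2) k) :
    Function.Injective (pairMatAct k (g : Matrix (Fin 2) (Fin 2) k)) := by
  apply Function.LeftInverse.injective (g := pairMatAct k ((g⁻¹ : GL (Fin 2) k) : Matrix (Fin 2) (Fin 2) k))
  intro p
  rw [mat_eq ((g⁻¹ : GL (Fin 2) k) : Matrix (Fin 2) (Fin 2) k), aeval_mat, act3_mul, act3_mul, ← Matrix.map_mul,
    ← Matrix.GeneralLinearGroup.coe_mul, inv_mul_cancel, Units.val_one,
    Matrix.map_one _ (map_zero _) (map_one _), act3_one, act3_one, aeval_gen]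
lemma scale_inj (c : kˣ) : Function.Injective (pairScaleAct k c) := by
  apply Function.LeftInverse.injective (g := pairScaleAct k c⁻¹)
  intro p
  rw [scale_eq c⁻¹, aeval_scale, smul_smul, smul_smul, ← map_mul, ← map_mul,
    inv_inv, Units.inv_mul, Units.mul_inv, map_one, one_smul, one_smul, aeval_gen]
lemma swap_inj : Function.Injective (pairSwapAct k) := by
  apply Function.LeftInverse.injective (g := pairSwapAct k)
  intro p
  rw [swap_eq (pairSwapAct k p), aeval_swap, aeval_gen]
end


lemma mem_iInf_IF {k E ι : Type*} [Field k] [Field E] [Algebra k E]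
    (K : ι → IntermediateField k E) (u : E) : u ∈ (⨅ i, K i) ↔ ∀ i, u ∈ K i := by
  rw [← SetLike.mem_coe, IntermediateField.coe_iInf]
  simp

section
variable (k : Type*) [Field k]

/-- Invariants of `GL₂` and scalings. -/
def Lsmall : IntermediateField k (FractionRing (PairRing k)) :=
  (⨅ g : GL (Fin 2) k, fixIF (extF (pairMatAct k (g : Matrix (Fin 2) (Fin 2) k)) (mat_inj g))) ⊓
    (⨅ c : kˣ, fixIF (extF (pairScaleAct k c) (scale_inj c)))

/-- Invariants of the full group. -/
def Lfull : IntermediateField k (FractionRing (PairRing k)) :=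
  Lsmall k ⊓ fixIF (extF (pairSwapAct k) swap_inj)

variable {k}

lemma mem_Lsmall (u : FractionRing (PairRing k)) : u ∈ Lsmall k ↔
    (∀ g : GL (Fin 2) k,
      extF (pairMatAct k (g : Matrix (Fin 2) (Fin 2) k)) (mat_inj g) u = u) ∧
    (∀ c : kˣ, extF (pairScaleAct k c) (scale_inj c) u = u) := by
  unfold Lsmall
  rw [IntermediateField.mem_inf, mem_iInf_IF, mem_iInf_IF]
  simp [mem_fixIF]

lemma mem_Lfull (u : FractionRing (PairRing k)) : u ∈ Lfull k ↔ PairRatInvariant k u := by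
  unfold Lfull PairRatInvariant
  rw [IntermediateField.mem_inf, mem_Lsmall, mem_fixIF, and_assoc]
  refine and_congr (forall_congr' fun g => ?_) (and_congr (forall_congr' fun c => ?_) ?_)
  · rw [← extF_iff]
  · rw [← extF_iff]
  · rw [← extF_iff]

/-- Restriction to the slice. -/
def rho : PairRing k →ₐ[k] MvPolynomial (Fin 3) k := aeval (Sum.elim sliceA (sliceB X))

lemma exists_res [IsAlgClosed k] (h2 : (2 : k) ≠ 0) (h3 : (3 : k) ≠ 0)
    (u : FractionRing (PairRing k)) (hu : u ∈ Lsmall k) (hu0 : u ≠ 0) :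
    ∃ e, e ≠ 0 ∧ Res rho u e := by
  obtain ⟨p, q, hq, rfl⟩ := IsFractionRing.div_surjective (PairRing k) u
  have hq0 : q ≠ 0 := nonZeroDivisors.ne_zero hq
  have hp0 : p ≠ 0 := by rintro rfl; exact hu0 (by simp)
  have evalv : ∀ (x : Fin 4 ⊕ Fin 4 → k) , ∃ a b, x = Sum.elim a b := fun x =>
    ⟨fun i => x (Sum.inl i), fun i => x (Sum.inr i), by funext i; rcases i with i | i <;> rfl⟩
  have ga : ∀ a b : Fin 4 → k, (fun i => eval (Sum.elim a b) ((gA : Fin 4 → PairRing k) i)) = a := by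
    intro a b; funext i; simp [gA]
  have gb : ∀ a b : Fin 4 → k, (fun i => eval (Sum.elim a b) ((gB : Fin 4 → PairRing k) i)) = b := by
    intro a b; funext i; simp [gB]
  have nA : hsA (gA : Fin 4 → PairRing k) ≠ 0 := by
    intro h
    have := congrArg (eval (Sum.elim ![0, 1, 0, 0] ![0, 0, 0, 0])) h
    rw [hsA_map, ga] at this
    simp [hsA] at this
  have nD : discCubic (gA : Fin 4 → PairRing k) ≠ 0 := by
    intro h
    have := congrArg (eval (Sum.elim ![0, 1, 1, 0] ![0, 0, 0, 0])) h
    rw [discCubic_map, ga] at this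
    simp [discCubic] at this
  have nH : Hc (gA : Fin 4 → PairRing k) gB ≠ 0 := by
    intro h
    have := congrArg (eval (Sum.elim ![0, 1, 0, 0] ![0, 0, 1, 0])) h
    rw [Hc_map, ga, gb] at this
    simp [Hc] at this
  have hN : p * q * (hsA gA * discCubic gA * Hc gA gB) ≠ 0 :=
    mul_ne_zero (mul_ne_zero hp0 hq0) (mul_ne_zero (mul_ne_zero nA nD) nH)
  obtain ⟨x, hx⟩ : ∃ x, eval x (p * q * (hsA gA * discCubic gA * Hc gA gB)) ≠ 0 := by
    by_contra hcon
    push Not at hcon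
    exact hN (MvPolynomial.funext fun x => by rw [hcon x, map_zero])
  obtain ⟨a, b, rfl⟩ := evalv x
  simp only [map_mul, hsA_map, discCubic_map, Hc_map, ga, gb, mul_ne_zero_iff] at hx
  obtain ⟨⟨hp, hq'⟩, ⟨hxA, hxD⟩, hxH⟩ := hx
  obtain ⟨g, c, v, hav, hbv⟩ := pair_normal h2 h3 a b hxA hxD hxH
  have key : ∀ f : PairRing k, eval v (rho (pairScaleAct k c (pairMatAct k g f))) =
      eval (Sum.elim a b) f := by
    intro f
    have : (aeval v).comp rho = (aeval (Sum.elim sliceA (sliceB v)) : PairRing k →ₐ[k] k) := by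
      apply MvPolynomial.algHom_ext
      rintro (i | i) <;> fin_cases i <;> simp [rho, sliceA, sliceB]
    have h1 := DFunLike.congr_fun this (pairScaleAct k c (pairMatAct k g f))
    rw [aeval_scale, aeval_mat] at h1
    have hid : (g : Matrix (Fin 2) (Fin 2) k).map (algebraMap k k) = g := by ext; simp
    rw [hid] at h1
    simp only [Algebra.algebraMap_self, RingHom.id_apply, hav, hbv] at h1
    exact h1
  obtain ⟨hum, hus⟩ := (mem_Lsmall _).1 hu
  set u := algebraMap (PairRing k) (FractionRing (PairRing k)) p /
    algebraMap (PairRing k) (FractionRing (PairRing k)) q with hudef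
  have e0 : u * algebraMap _ _ q = algebraMap _ _ p := by
    rw [hudef]; field_simp [aM_ne hq0]
  have e1 := (extF_iff _ (mat_inj g) u).2 (hum g) p q e0
  have e2 := (extF_iff _ (scale_inj c) u).2 (hus c) _ _ e1
  have n1 : rho (pairScaleAct k c (pairMatAct k g q)) ≠ 0 := by
    intro h; apply hq'; rw [← key, h, map_zero]
  have n2 : rho (pairScaleAct k c (pairMatAct k g p)) ≠ 0 := by
    intro h; apply hp; rw [← key, h, map_zero]
  refine ⟨algebraMap _ _ (rho (pairScaleAct k c (pairMatAct k g p))) /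
    algebraMap _ _ (rho (pairScaleAct k c (pairMatAct k g q))), div_ne_zero (aM_ne n2) (aM_ne n1),
    _, _, n1, e2, ?_⟩
  rw [div_mul_cancel₀ _ (aM_ne n1)]

lemma res_inj [IsAlgClosed k] (h2 : (2 : k) ≠ 0) (h3 : (3 : k) ≠ 0)
    (u v : FractionRing (PairRing k)) (hu : u ∈ Lsmall k) (hv : v ∈ Lsmall k)
    (e : FractionRing (MvPolynomial (Fin 3) k)) (h : Res rho u e) (h' : Res rho v e) : u = v := by
  by_contra hne
  obtain ⟨e', he', hr⟩ := exists_res h2 h3 (u - v) (sub_mem hu hv) (sub_ne_zero.2 hne)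
  have := (h.sub h').unique hr
  rw [sub_self] at this
  exact he' this.symm

/-! Action on the basic invariants -/

local notation "φ" => algebraMap (PairRing k) (FractionRing (PairRing k))

lemma mat_comp (g : GL (Fin 2) k) (Φ : (Fin 4 → PairRing k) → (Fin 4 → PairRing k) → PairRing k)
    (hm : ∀ (f : PairRing k →+* PairRing k) a b, f (Φ a b) = Φ (fun i => f (a i)) (fun i => f (b i)))
    (w : ℕ) (hw : ∀ (f : k →+* PairRing k) (g : Matrix (Fin 2) (Fin 2) k) (a b : Fin 4 → PairRing k),
      g.det ≠ 0 → Φ (act3 (g.map f) a) (act3 (g.map f) b) = f g.det ^ w * Φ a b) :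
    extF _ (mat_inj g) (φ (Φ gA gB)) =
      φ (C (g : Matrix (Fin 2) (Fin 2) k).det) ^ w * φ (Φ gA gB) := by
  rw [extF_algebraMap]
  have := hm (pairMatAct k (g : Matrix (Fin 2) (Fin 2) k)).toRingHom gA gB
  have hg : (g : Matrix (Fin 2) (Fin 2) k).det ≠ 0 := g.det_ne_zero
  have e1 : (fun i => (pairMatAct k (g : Matrix (Fin 2) (Fin 2) k)).toRingHom (gA i)) =
      act3 ((g : Matrix (Fin 2) (Fin 2) k).map (algebraMap k (PairRing k))) gA := by
    funext i; change pairMatAct k _ (X _) = _; rw [mat_eq, aeval_X]; rfl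
  have e2 : (fun i => (pairMatAct k (g : Matrix (Fin 2) (Fin 2) k)).toRingHom (gB i)) =
      act3 ((g : Matrix (Fin 2) (Fin 2) k).map (algebraMap k (PairRing k))) gB := by
    funext i; change pairMatAct k _ (X _) = _; rw [mat_eq, aeval_X]; rfl
  rw [e1, e2, hw _ _ _ _ hg] at this
  rw [← map_pow, ← map_mul]
  exact congrArg _ this

lemma scale_comp (c : kˣ) (Φ : (Fin 4 → PairRing k) → (Fin 4 → PairRing k) → PairRing k)
    (hm : ∀ (f : PairRing k →+* PairRing k) a b, f (Φ a b) = Φ (fun i => f (a i)) (fun i => f (b i)))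
    (w : ℕ) (hw : ∀ (c d : PairRing k) (a b : Fin 4 → PairRing k),
      c * d = 1 → Φ (c • a) (d • b) = c ^ w * Φ a b) :
    extF _ (scale_inj c) (φ (Φ gA gB)) = φ (C (c : k)) ^ w * φ (Φ gA gB) := by
  rw [extF_algebraMap]
  have := hm (pairScaleAct k c).toRingHom gA gB
  have e1 : (fun i => (pairScaleAct k c).toRingHom (gA i)) =
      algebraMap k (PairRing k) c • gA := by
    funext i; change pairScaleAct k _ (X _) = _; rw [scale_eq, aeval_X]; rfl
  have e2 : (fun i => (pairScaleAct k c).toRingHom (gB i)) =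
      algebraMap k (PairRing k) ((c⁻¹ : kˣ) : k) • gB := by
    funext i; change pairScaleAct k _ (X _) = _; rw [scale_eq, aeval_X]; rfl
  rw [e1, e2, hw _ _ _ _ (by rw [← map_mul, Units.mul_inv, map_one])] at this
  rw [← map_pow, ← map_mul]
  exact congrArg _ this

lemma swap_comp (Φ : (Fin 4 → PairRing k) → (Fin 4 → PairRing k) → PairRing k)
    (hm : ∀ (f : PairRing k →+* PairRing k) a b, f (Φ a b) = Φ (fun i => f (a i)) (fun i => f (b i))) :
    extF _ swap_inj (φ (Φ gA gB)) = φ (Φ gB gA) := by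
  rw [extF_algebraMap]
  have := hm (pairSwapAct k).toRingHom gA gB
  have e1 : (fun i => (pairSwapAct k).toRingHom (gA i)) = gB := by
    funext i; change pairSwapAct k (X _) = _; rw [swap_eq, aeval_X]; rfl
  have e2 : (fun i => (pairSwapAct k).toRingHom (gB i)) = gA := by
    funext i; change pairSwapAct k (X _) = _; rw [swap_eq, aeval_X]; rfl
  rw [e1, e2] at this
  exact congrArg _ this

lemma R_small (Φ : (Fin 4 → PairRing k) → (Fin 4 → PairRing k) → PairRing k) (n : ℕ)
    (hm : ∀ (f : PairRing k →+* PairRing k) a b, f (Φ a b) = Φ (fun i => f (a i)) (fun i => f (b i)))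
    (hw : ∀ (f : k →+* PairRing k) (g : Matrix (Fin 2) (Fin 2) k) (a b : Fin 4 → PairRing k),
      g.det ≠ 0 → Φ (act3 (g.map f) a) (act3 (g.map f) b) = f g.det ^ (3 * n) * Φ a b)
    (hs : ∀ (c d : PairRing k) (a b : Fin 4 → PairRing k),
      c * d = 1 → Φ (c • a) (d • b) = Φ a b) :
    φ (Hc gA gB) ^ n / φ (Φ gA gB) ∈ Lsmall k := by
  rw [mem_Lsmall]
  constructor
  · intro g
    rw [map_div₀, map_pow, mat_comp g Hc Hc_map 3 Hc_cov, mat_comp g Φ hm _ hw, mul_pow, ← pow_mul]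
    apply mul_div_mul_left
    apply pow_ne_zero
    apply aM_ne
    simpa using g.det_ne_zero
  · intro c
    rw [map_div₀, map_pow,
      scale_comp c Hc Hc_map 0 (fun c d a b h => by rw [Hc_scale c d a b h]; simp),
      scale_comp c Φ hm 0 (fun c d a b h => by rw [hs c d a b h]; simp)]
    simp

lemma R_full : φ (Hc gA gB) ^ 2 / φ (Ic gA gB) ∈ Lfull k ∧
    φ (Hc gA gB) ^ 3 / φ (Rc gA gB) ∈ Lfull k ∧ φ (Hc gA gB) ^ 4 / φ (Dc gA gB) ∈ Lfull k := by
  refine ⟨IntermediateField.mem_inf.2 ⟨R_small Ic 2 Ic_map Ic_cov Ic_scale, ?_⟩,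
    IntermediateField.mem_inf.2 ⟨R_small Rc 3 Rc_map Rc_cov Rc_scale, ?_⟩,
    IntermediateField.mem_inf.2 ⟨R_small Dc 4 Dc_map Dc_cov Dc_scale, ?_⟩⟩
  · rw [mem_fixIF, map_div₀, map_pow, swap_comp Hc Hc_map, swap_comp Ic Ic_map, Hc_swap, Ic_swap]
    simp
  · rw [mem_fixIF, map_div₀, map_pow, swap_comp Hc Hc_map, swap_comp Rc Rc_map, Hc_swap, Rc_swap,
      map_neg, map_neg, Odd.neg_pow (by decide), neg_div_neg_eq]
  · rw [mem_fixIF, map_div₀, map_pow, swap_comp Hc Hc_map, swap_comp Dc Dc_map, Hc_swap, Dc_swap,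
      map_neg, Even.neg_pow (by decide)]

/-- The half-invariant function. -/
def Nfun : FractionRing (PairRing k) := φ (Jc gA gB) / (φ (discCubic gA) * φ (Hc gA gB) ^ 2)

lemma Nfun_small : Nfun ∈ Lsmall k := by
  rw [mem_Lsmall]
  unfold Nfun
  constructor
  · intro g
    rw [map_div₀, map_mul, map_pow, mat_comp g Hc Hc_map 3 Hc_cov, mat_comp g Jc Jc_map 12 Jc_cov,
      mat_comp g (fun a _ => discCubic a) (fun f a _ => discCubic_map f a) 6
        (fun f g a b => disc_cov f g a)]
    have : φ (C (g : Matrix (Fin 2) (Fin 2) k).det) ≠ 0 := by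
      apply aM_ne
      simpa using g.det_ne_zero
    rw [← mul_div_mul_left _ (φ (discCubic gA) * φ (Hc gA gB) ^ 2) (pow_ne_zero 12 this)]
    congr 1
    ring
  · intro c
    rw [map_div₀, map_mul, map_pow,
      scale_comp c Hc Hc_map 0 (fun c d a b h => by rw [Hc_scale c d a b h]; simp),
      scale_comp c Jc Jc_map 4 (fun c d a b h => by rw [Jc_scale c d a b h]),
      scale_comp c (fun a _ => discCubic a) (fun f a _ => discCubic_map f a) 4
        (fun c d a b h => by rw [discCubic_scale c a])]
    have : φ (C (c : k)) ≠ 0 := by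
      apply aM_ne
      simp
    rw [← mul_div_mul_left _ (φ (discCubic gA) * φ (Hc gA gB) ^ 2) (pow_ne_zero 4 this)]
    congr 1
    ring

lemma Nfun_swap (h3 : (3 : k) ≠ 0) : (Nfun : FractionRing (PairRing k)) ∉ Lfull k := by
  intro h
  have h := (IntermediateField.mem_inf.1 h).2
  rw [mem_fixIF] at h
  unfold Nfun at h
  rw [map_div₀, map_mul, map_pow, swap_comp Hc Hc_map, swap_comp Jc Jc_map,
    swap_comp (fun a _ => discCubic a) (fun f a _ => discCubic_map f a), Hc_swap, map_neg, neg_sq] at h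
  have ga : ∀ a b : Fin 4 → k, (fun i => eval (Sum.elim a b) ((gA : Fin 4 → PairRing k) i)) = a := by
    intro a b; funext i; simp [gA]
  have gb : ∀ a b : Fin 4 → k, (fun i => eval (Sum.elim a b) ((gB : Fin 4 → PairRing k) i)) = b := by
    intro a b; funext i; simp [gB]
  have nD : discCubic (gA : Fin 4 → PairRing k) ≠ 0 := by
    intro h
    have := congrArg (eval (Sum.elim ![0, 1, 1, 0] ![0, 0, 0, 0])) h
    rw [discCubic_map, ga] at this
    simp [discCubic] at this
  have nD' : discCubic (gB : Fin 4 → PairRing k) ≠ 0 := by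
    intro h
    have := congrArg (eval (Sum.elim ![0, 0, 0, 0] ![0, 1, 1, 0])) h
    rw [discCubic_map, gb] at this
    simp [discCubic] at this
  have nH : Hc (gA : Fin 4 → PairRing k) gB ≠ 0 := by
    intro h
    have := congrArg (eval (Sum.elim ![0, 1, 0, 0] ![0, 0, 1, 0])) h
    rw [Hc_map, ga, gb] at this
    simp [Hc] at this
  have n1 := aM_ne nD
  have n2 := aM_ne nD'
  have n3 := aM_ne nH
  rw [div_eq_div_iff (mul_ne_zero n2 (pow_ne_zero 2 n3)) (mul_ne_zero n1 (pow_ne_zero 2 n3))] at h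
  have h' : φ (Jc gB gA * discCubic gA) = φ (Jc gA gB * discCubic gB) := by
    apply mul_right_cancel₀ (pow_ne_zero 2 n3)
    rw [map_mul, map_mul]
    linear_combination h
  have h'' := congrArg (eval (Sum.elim ![1, 0, 0, 1] ![0, 0, 1, 0]))
    (IsFractionRing.injective (PairRing k) (FractionRing (PairRing k)) h')
  rw [map_mul, map_mul, Jc_map, Jc_map, discCubic_map, discCubic_map, ga, gb] at h''
  simp [Jc, hsA, hsB, hsC, ln0, ln1, discCubic] at h''
  have e27 : (27 : k) = 3 ^ 3 := by norm_num
  rw [e27] at h''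
  simp [h3] at h''

end


lemma simple_ext {k E : Type*} [Field k] [Field E] [Algebra k E] (A : IntermediateField k E)
    (x : E) (p : Polynomial A) (hp : p ≠ 0) (hx : Polynomial.aeval x p = 0) (e : E)
    (he : e ∈ IntermediateField.adjoin k ((A : Set E) ∪ {x})) :
    ∃ q : Polynomial A, q.degree < p.degree ∧ Polynomial.aeval x q = e := by
  have halg : IsAlgebraic A x := ⟨p, hp, hx⟩
  rw [← IntermediateField.restrictScalars_adjoin, IntermediateField.mem_restrictScalars] at he
  have h2 : e ∈ (IntermediateField.adjoin A {x}).toSubalgebra := he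
  rw [IntermediateField.adjoin_simple_toSubalgebra_of_isAlgebraic halg,
    Algebra.adjoin_singleton_eq_range_aeval] at h2
  obtain ⟨f, hf⟩ := h2
  refine ⟨f % p, EuclideanDomain.mod_lt f hp, ?_⟩
  have h3 := congrArg (Polynomial.aeval x) (EuclideanDomain.div_add_mod f p)
  rw [map_add, map_mul, hx, zero_mul, zero_add] at h3
  rw [h3]; exact hf

lemma quad_ext {k E : Type*} [Field k] [Field E] [Algebra k E] (A : IntermediateField k E)
    (x : E) (c0 c1 c2 : A) (hc : c2 ≠ 0) (hx : (c2 : E) * x ^ 2 + c1 * x + c0 = 0) (e : E)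
    (he : e ∈ IntermediateField.adjoin k ((A : Set E) ∪ {x})) :
    ∃ a b : E, a ∈ A ∧ b ∈ A ∧ e = a + b * x := by
  have hd := Polynomial.degree_quadratic (b := c1) (c := c0) hc
  obtain ⟨q, hq, rfl⟩ := simple_ext A x
    (Polynomial.C c2 * Polynomial.X ^ 2 + Polynomial.C c1 * Polynomial.X + Polynomial.C c0)
    (by intro h; rw [h] at hd; simp at hd) (by simpa [IntermediateField.algebraMap_apply] using hx) e he
  rw [hd] at hq
  have hq' : q.natDegree < 2 := by
    rcases eq_or_ne q 0 with rfl | h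
    · simp
    · exact (Polynomial.natDegree_lt_iff_degree_lt h).2 hq
  refine ⟨q.coeff 0, q.coeff 1, (q.coeff 0).2, (q.coeff 1).2, ?_⟩
  rw [Polynomial.aeval_eq_sum_range' hq']
  simp [Finset.sum_range_succ, Algebra.smul_def]

lemma cub_ext {k E : Type*} [Field k] [Field E] [Algebra k E] (A : IntermediateField k E)
    (x : E) (hx : x ^ 3 ∈ A) (e : E)
    (he : e ∈ IntermediateField.adjoin k ((A : Set E) ∪ {x})) :
    ∃ a b c : E, a ∈ A ∧ b ∈ A ∧ c ∈ A ∧ e = a + b * x + c * x ^ 2 := by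
  have hd := Polynomial.degree_X_pow_sub_C (n := 3) (by norm_num) (⟨x ^ 3, hx⟩ : A)
  obtain ⟨q, hq, rfl⟩ := simple_ext A x (Polynomial.X ^ 3 - Polynomial.C (⟨x ^ 3, hx⟩ : A))
    (by intro h; rw [h] at hd; simp at hd) (by simp [IntermediateField.algebraMap_apply]) e he
  rw [hd] at hq
  have hq' : q.natDegree < 3 := by
    rcases eq_or_ne q 0 with rfl | h
    · simp
    · exact (Polynomial.natDegree_lt_iff_degree_lt h).2 hq
  refine ⟨q.coeff 0, q.coeff 1, q.coeff 2, (q.coeff 0).2, (q.coeff 1).2, (q.coeff 2).2, ?_⟩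
  rw [Polynomial.aeval_eq_sum_range' hq']
  simp [Finset.sum_range_succ, Algebra.smul_def]

section
variable {k : Type*} [Field k]

/-- Multiplication of `y, z` by cube roots of unity. -/
def sig1 (ω : k) : MvPolynomial (Fin 3) k →ₐ[k] MvPolynomial (Fin 3) k :=
  aeval ![X 0, C ω * X 1, C (ω ^ 2) * X 2]
/-- The involution of the slice. -/
def sig2 : MvPolynomial (Fin 3) k →ₐ[k] MvPolynomial (Fin 3) k :=
  aeval ![-X 0 - 1, -X 2, -X 1]

lemma sig1_inj (ω : k) (hω : ω ^ 3 = 1) : Function.Injective (sig1 ω) := by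
  apply Function.LeftInverse.injective (g := (sig1 (ω ^ 2)))
  intro p
  have : (sig1 (ω ^ 2)).comp (sig1 ω) = AlgHom.id k _ := by
    apply MvPolynomial.algHom_ext
    intro i
    fin_cases i
    · simp [sig1]
    · simp [sig1]
      rw [show C ω * (C ω ^ 2 * X 1) = C (ω ^ 3) * (X 1 : MvPolynomial (Fin 3) k) by
        simp only [map_pow]; ring, hω]; simp
    · simp [sig1]
      rw [show C ω ^ 2 * ((C ω ^ 2) ^ 2 * X 2) = C ((ω ^ 3) ^ 2) * (X 2 : MvPolynomial (Fin 3) k) by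
        simp only [map_pow]; ring, hω]; simp
  exact DFunLike.congr_fun this p

lemma sig2_inj : Function.Injective (sig2 (k := k)) := by
  apply Function.LeftInverse.injective (g := sig2 (k := k))
  intro p
  have : (sig2 (k := k)).comp sig2 = AlgHom.id k _ := by
    apply MvPolynomial.algHom_ext
    intro i
    fin_cases i <;> simp [sig2]
  exact DFunLike.congr_fun this p

lemma sig_rho (σ : MvPolynomial (Fin 3) k →ₐ[k] MvPolynomial (Fin 3) k) (p : PairRing k) :
    σ (rho p) = aeval (Sum.elim sliceA (sliceB fun i => σ (X i))) p := by
  have : σ.comp rho = aeval (Sum.elim sliceA (sliceB fun i => σ (X i))) := by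
    apply MvPolynomial.algHom_ext
    rintro (i | i) <;> fin_cases i <;> simp [rho, sliceA, sliceB]
  exact DFunLike.congr_fun this p

lemma sig1_fix (ω : k) (hω : ω ^ 3 = 1) (u : FractionRing (PairRing k)) (hu : u ∈ Lsmall k)
    (e : FractionRing (MvPolynomial (Fin 3) k)) (h : Res rho u e) :
    extF (sig1 ω) (sig1_inj ω hω) e = e := by
  obtain ⟨hm, -⟩ := (mem_Lsmall u).1 hu
  have hω0 : ω ≠ 0 := by rintro rfl; simp at hω
  have hdet : (!![1, 0; 0, ω] : Matrix (Fin 2) (Fin 2) k).det ≠ 0 := by simpa using hω0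
  let g : GL (Fin 2) k := Matrix.GeneralLinearGroup.mkOfDetNeZero _ hdet
  have h1 := h.extF _ (mat_inj g) (sig1 ω) (sig1_inj ω hω) (by
    intro p
    rw [sig_rho]
    unfold rho
    rw [aeval_mat]
    have hC : (C ω : MvPolynomial (Fin 3) k) ^ 3 = 1 := by rw [← C_pow, hω, C_1]
    have hg : ((g : Matrix (Fin 2) (Fin 2) k)).map (algebraMap k (MvPolynomial (Fin 3) k)) =
        !![1, 0; 0, C ω] := by
      ext1 i j
      change algebraMap k _ ((!![1, 0; 0, ω] : Matrix (Fin 2) (Fin 2) k) i j) = _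
      fin_cases i <;> fin_cases j <;> simp
    rw [hg, act3_diag, act3_diag]
    congr 2
    congr 1
    · funext i; fin_cases i <;> simp [sliceA, hC]
    · funext i; fin_cases i <;> simp [sliceB, sig1, hC] <;> ring)
  rw [hm g] at h1
  exact h1.unique h

lemma sig2_fix [IsAlgClosed k] (u : FractionRing (PairRing k)) (hu : u ∈ Lsmall k)
    (e : FractionRing (MvPolynomial (Fin 3) k)) (h : Res rho u e) :
    extF sig2 sig2_inj e = e := by
  obtain ⟨hm, hs⟩ := (mem_Lsmall u).1 hu
  obtain ⟨j, hj⟩ := IsAlgClosed.exists_eq_mul_self (-1 : k)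
  have hj0 : j ≠ 0 := by rintro rfl; simp at hj
  have hdet : (!![0, j; j, 0] : Matrix (Fin 2) (Fin 2) k).det ≠ 0 := by simpa using hj0
  let g : GL (Fin 2) k := Matrix.GeneralLinearGroup.mkOfDetNeZero _ hdet
  have hji : j⁻¹ = -j := by
    apply mul_left_cancel₀ hj0
    rw [mul_inv_cancel₀ hj0]
    linear_combination -hj
  let c : kˣ := Units.mk0 j hj0
  have hθ : Function.Injective ((pairScaleAct k c).comp
      (pairMatAct k (g : Matrix (Fin 2) (Fin 2) k))) := (scale_inj c).comp (mat_inj g)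
  have hfix : extF _ hθ u = u := (extF_iff _ hθ u).1 fun p q h =>
    (extF_iff _ (scale_inj c) u).2 (hs c) _ _ ((extF_iff _ (mat_inj g) u).2 (hm g) p q h)
  have h1 := h.extF _ hθ sig2 sig2_inj (by
    intro p
    rw [sig_rho, AlgHom.comp_apply]
    unfold rho
    rw [aeval_scale, aeval_mat]
    have hC : (C j : MvPolynomial (Fin 3) k) ^ 2 = -1 := by
      rw [← C_pow, sq, ← hj, map_neg, C_1]
    have hg : ((g : Matrix (Fin 2) (Fin 2) k)).map (algebraMap k (MvPolynomial (Fin 3) k)) =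
        !![0, C j; C j, 0] := by
      ext1 i j'
      change algebraMap k _ ((!![0, j; j, 0] : Matrix (Fin 2) (Fin 2) k) i j') = _
      fin_cases i <;> fin_cases j' <;> simp
    have hc1 : algebraMap k (MvPolynomial (Fin 3) k) (c : k) = C j := rfl
    have hc2 : algebraMap k (MvPolynomial (Fin 3) k) ((c⁻¹ : kˣ) : k) = -C j := by
      rw [← map_neg, ← hji]; rfl
    rw [hg, hc1, hc2]
    congr 2
    congr 1
    · funext i
      fin_cases i <;> simp [act3, sliceA]
      · linear_combination (C j ^ 2 - 1) * hC
      · linear_combination (C j ^ 2 - 1) * hC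
    · funext i
      fin_cases i <;> simp [act3, sliceB, sig2]
      · linear_combination (-(C j ^ 2 - 1) * (X 0 + 1)) * hC
      · linear_combination ((C j ^ 2 - 1) * X 2) * hC
      · linear_combination ((C j ^ 2 - 1) * X 1) * hC
      · linear_combination ((C j ^ 2 - 1) * X 0) * hC)
  rw [hfix] at h1
  exact h1.unique h
end


lemma tower {k E : Type*} [Field k] [Field E] [Algebra k E] (h2 : (2 : E) ≠ 0) (h3 : (3 : E) ≠ 0)
    (t y z ω : E) (hgen : ∀ B : IntermediateField k E, t ∈ B → y ∈ B → z ∈ B → ∀ e, e ∈ B)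
    (hω : 1 + ω + ω ^ 2 = 0) (σ σ' τ : E →ₐ[k] E)
    (st : σ t = t) (sy : σ y = ω * y) (sz : σ z = ω ^ 2 * z)
    (st' : σ' t = t) (sy' : σ' y = ω ^ 2 * y) (sz' : σ' z = ω * z)
    (tt : τ t = -t - 1) (ty : τ y = -z) (tz : τ z = -y)
    (A0 : IntermediateField k E) (i r δ : E)
    (hi : i = 9 * (t * (t + 1)) - y * z) (hr : r = y ^ 3 - z ^ 3 + 3 * (y * z))
    (hδ : δ = -27 * t ^ 2 * (t + 1) ^ 2 + 18 * t * (t + 1) * z * y + y ^ 2 * z ^ 2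
      - 4 * y ^ 3 * (t + 1) - 4 * z ^ 3 * t)
    (iA : i ∈ A0) (rA : r ∈ A0) (dA : δ ∈ A0) (hδ0 : δ ≠ 0) (hy : y ≠ 0) (hs : 2 * t + 1 ≠ 0)
    (A0σ : A0 ≤ fixIF σ) (A0σ' : A0 ≤ fixIF σ') (A0τ : A0 ≤ fixIF τ)
    (e : E) (eσ : σ e = e) (eσ' : σ' e = e) (eτ : τ e = e) :
    ∃ a b : E, a ∈ A0 ∧ b ∈ A0 ∧ e = a + b * (y * z) := by
  have ω3 : ω ^ 3 = 1 := by linear_combination (ω - 1) * hω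
  have h9 : (9 : E) ≠ 0 := by
    rw [show (9 : E) = 3 * 3 by norm_num]; exact mul_ne_zero h3 h3
  obtain ⟨n, hn⟩ : ∃ n, n = y * z := ⟨_, rfl⟩
  obtain ⟨s, hsd⟩ : ∃ s, s = 2 * t + 1 := ⟨_, rfl⟩
  obtain ⟨m, hm⟩ : ∃ m, m = t * (t + 1) := ⟨_, rfl⟩
  obtain ⟨d, hd⟩ : ∃ d, d = y ^ 3 - z ^ 3 := ⟨_, rfl⟩
  obtain ⟨w, hw⟩ : ∃ w, w = s * (y ^ 3 + z ^ 3) := ⟨_, rfl⟩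
  have hs0 : s ≠ 0 := by rw [hsd]; exact hs
  -- first level
  obtain ⟨A1, hA1⟩ : ∃ A1, A1 = IntermediateField.adjoin k ((A0 : Set E) ∪ {n}) := ⟨_, rfl⟩
  have A01 : ∀ x ∈ A0, x ∈ A1 := fun x hx => by
    rw [hA1]; exact IntermediateField.subset_adjoin _ _ (Or.inl hx)
  have nA1 : n ∈ A1 := by
    rw [hA1]; exact IntermediateField.subset_adjoin _ _ (Or.inr rfl)
  have mA1 : m ∈ A1 := by
    have : m = (i + n) / 9 := by rw [hi, hn, hm]; field_simp; ring
    rw [this]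
    exact div_mem (add_mem (A01 _ iA) nA1) (ofNat_mem A1 9)
  have dA1 : d ∈ A1 := by
    have : d = r - 3 * n := by rw [hr, hn, hd]; ring
    rw [this]
    exact sub_mem (A01 _ rA) (mul_mem (ofNat_mem A1 3) nA1)
  have wA1 : w ∈ A1 := by
    have : w = (-(27 * m ^ 2) + 18 * m * n + n ^ 2 - δ) / 2 - d := by
      rw [hδ, hw, hm, hd, hn, hsd]; field_simp; ring
    rw [this]
    refine sub_mem (div_mem (sub_mem (add_mem (add_mem (neg_mem ?_) ?_) ?_) (A01 _ dA))
      (ofNat_mem A1 2)) dA1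
    · exact mul_mem (ofNat_mem A1 27) (pow_mem mA1 2)
    · exact mul_mem (mul_mem (ofNat_mem A1 18) mA1) nA1
    · exact pow_mem nA1 2
  -- second level
  obtain ⟨A2, hA2⟩ : ∃ A2, A2 = IntermediateField.adjoin k ((A1 : Set E) ∪ {s}) := ⟨_, rfl⟩
  have A12 : ∀ x ∈ A1, x ∈ A2 := fun x hx => by
    rw [hA2]; exact IntermediateField.subset_adjoin _ _ (Or.inl hx)
  have sA2 : s ∈ A2 := by
    rw [hA2]; exact IntermediateField.subset_adjoin _ _ (Or.inr rfl)
  have y3A2 : y ^ 3 ∈ A2 := by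
    have : y ^ 3 = (w / s + d) / 2 := by
      rw [hw, hd]; field_simp; ring
    rw [this]
    exact div_mem (add_mem (div_mem (A12 _ wA1) sA2) (A12 _ dA1)) (ofNat_mem A2 2)
  -- third level
  obtain ⟨A3, hA3⟩ : ∃ A3, A3 = IntermediateField.adjoin k ((A2 : Set E) ∪ {y}) := ⟨_, rfl⟩
  have A23 : ∀ x ∈ A2, x ∈ A3 := fun x hx => by
    rw [hA3]; exact IntermediateField.subset_adjoin _ _ (Or.inl hx)
  have yA3 : y ∈ A3 := by
    rw [hA3]; exact IntermediateField.subset_adjoin _ _ (Or.inr rfl)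
  have tA3 : t ∈ A3 := by
    have : t = (s - 1) / 2 := by rw [hsd]; field_simp; ring
    rw [this]
    exact div_mem (sub_mem (A23 _ sA2) (one_mem A3)) (ofNat_mem A3 2)
  have zA3 : z ∈ A3 := by
    have : z = n / y := by rw [hn]; field_simp
    rw [this]
    exact div_mem (A23 _ (A12 _ nA1)) yA3
  have eA3 := hgen A3 tA3 yA3 zA3 e
  -- fixed fields
  have A1fix : ∀ θ : E →ₐ[k] E, A0 ≤ fixIF θ → θ n = n → A1 ≤ fixIF θ := by
    intro θ h1 h2
    rw [hA1, IntermediateField.adjoin_le_iff]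
    rintro x (hx | hx)
    · exact h1 hx
    · rw [Set.mem_singleton_iff.1 hx]; exact h2
  have A2fix : ∀ θ : E →ₐ[k] E, A0 ≤ fixIF θ → θ n = n → θ s = s → A2 ≤ fixIF θ := by
    intro θ h1 h2 h3
    rw [hA2, IntermediateField.adjoin_le_iff]
    rintro x (hx | hx)
    · exact A1fix θ h1 h2 hx
    · rw [Set.mem_singleton_iff.1 hx]; exact h3
  have f1 : A2 ≤ fixIF σ := A2fix σ A0σ
    (by rw [hn, map_mul, sy, sz]; linear_combination (y * z) * ω3)
    (by rw [hsd, map_add, map_mul, st, map_one, map_ofNat])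
  have f1' : A2 ≤ fixIF σ' := A2fix σ' A0σ'
    (by rw [hn, map_mul, sy', sz']; linear_combination (y * z) * ω3)
    (by rw [hsd, map_add, map_mul, st', map_one, map_ofNat])
  have f2 : A1 ≤ fixIF τ := A1fix τ A0τ (by rw [hn, map_mul, ty, tz]; ring)
  have τs : τ s = -s := by rw [hsd, map_add, map_mul, tt, map_one, map_ofNat]; ring
  -- descend to A2
  have eA2 : e ∈ A2 := by
    obtain ⟨a, b, c, ha, hb, hc, he⟩ := cub_ext A2 y y3A2 e (hA3 ▸ eA3)
    have e1 := congrArg σ he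
    rw [eσ, map_add, map_add, map_mul, map_mul, map_pow, sy, (mem_fixIF _ _).1 (f1 ha),
      (mem_fixIF _ _).1 (f1 hb), (mem_fixIF _ _).1 (f1 hc)] at e1
    have e2 := congrArg σ' he
    rw [eσ', map_add, map_add, map_mul, map_mul, map_pow, sy', (mem_fixIF _ _).1 (f1' ha),
      (mem_fixIF _ _).1 (f1' hb), (mem_fixIF _ _).1 (f1' hc)] at e2
    have : e = a := by
      apply mul_left_cancel₀ h3
      linear_combination he + e1 + e2 + (b * y + c * y ^ 2) * hω + c * y ^ 2 * ω * ω3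
    rw [this]; exact ha
  have eA1 : e ∈ A1 := by
    obtain ⟨a, b, ha, hb, he⟩ := quad_ext A1 s ⟨-(1 + 4 * m),
      neg_mem (add_mem (one_mem _) (mul_mem (ofNat_mem _ 4) mA1))⟩ 0 1 one_ne_zero
      (by simp only [IntermediateField.coe_one, IntermediateField.coe_zero]; rw [hsd, hm]; ring)
      e (hA2 ▸ eA2)
    have e1 := congrArg τ he
    rw [eτ, map_add, map_mul, τs, (mem_fixIF _ _).1 (f2 ha), (mem_fixIF _ _).1 (f2 hb)] at e1
    have : e = a := by
      apply mul_left_cancel₀ h2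
      linear_combination he + e1
    rw [this]; exact ha
  -- the quadratic equation of n
  have cA : ∀ N : ℕ, (N : E) ∈ A0 := fun N => natCast_mem A0 N
  obtain ⟨c, hc⟩ : ∃ c, c = -(i ^ 2 / 6) - r - δ / 2 := ⟨_, rfl⟩
  have cA : c ∈ A0 := by
    rw [hc]
    exact sub_mem (sub_mem (neg_mem (div_mem (pow_mem iA 2) (ofNat_mem A0 6))) rA)
      (div_mem dA (ofNat_mem A0 2))
  have h49 : (4 / 9 : E) ∈ A0 := div_mem (ofNat_mem A0 4) (ofNat_mem A0 9)
  have m1 : -(4 / 3 * δ) ∈ A0 :=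
    neg_mem (mul_mem (div_mem (ofNat_mem A0 4) (ofNat_mem A0 3)) dA)
  have m4 : 1 + 4 / 9 * i ∈ A0 := add_mem (one_mem A0) (mul_mem h49 iA)
  have m2 : 2 * c * (2 / 3 * i + 3) + 6 * r * (1 + 4 / 9 * i) - 4 / 9 * r ^ 2 ∈ A0 := by
    refine sub_mem (add_mem (mul_mem (mul_mem (ofNat_mem A0 2) cA) (add_mem (mul_mem
      (div_mem (ofNat_mem A0 2) (ofNat_mem A0 3)) iA) (ofNat_mem A0 3)))
      (mul_mem (mul_mem (ofNat_mem A0 6) rA) m4)) (mul_mem h49 (pow_mem rA 2))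
  have m3 : c ^ 2 - (1 + 4 / 9 * i) * r ^ 2 ∈ A0 :=
    sub_mem (pow_mem cA 2) (mul_mem m4 (pow_mem rA 2))
  have h4 : (4 : E) ≠ 0 := by
    rw [show (4 : E) = 2 * 2 by norm_num]; exact mul_ne_zero h2 h2
  have h6 : (6 : E) ≠ 0 := by
    rw [show (6 : E) = 2 * 3 by norm_num]; exact mul_ne_zero h2 h3
  obtain ⟨a, b, ha, hb, he⟩ := quad_ext A0 n ⟨_, m3⟩ ⟨_, m2⟩ ⟨_, m1⟩
    (by
      intro h0
      have := congrArg (Subtype.val) h0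
      simp only [ZeroMemClass.coe_zero, neg_eq_zero] at this
      exact mul_ne_zero (div_ne_zero h4 h3) hδ0 this)
    (by
      simp only
      have w1 : w = 4 / 3 * n ^ 2 + (2 / 3 * i + 3) * n + c := by
        rw [hc, hδ, hw, hn, hsd, hi, hr]; field_simp; ring
      have w2 : w ^ 2 = (1 + 4 / 9 * (i + n)) * ((r - 3 * n) ^ 2 + 4 * n ^ 3) := by
        rw [hw, hn, hsd, hi, hr]; field_simp; ring
      have dd : δ = -(i ^ 2 / 3) - 2 * r - 2 * c := by rw [hc]; field_simp; ring
      rw [w1] at w2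
      rw [dd]
      linear_combination (norm := skip) w2
      field_simp
      ring)
    e (hA1 ▸ eA1)
  exact ⟨a, b, ha, hb, hn ▸ he⟩


section
variable {k : Type*} [Field k]

lemma rho_gA : (fun i => (rho (k := k)).toRingHom (gA i)) = sliceA := by
  funext i; change rho (X _) = _; simp [rho]
lemma rho_gB : (fun i => (rho (k := k)).toRingHom (gB i)) = sliceB X := by
  funext i; change rho (X _) = _; simp [rho]

lemma rho_H : rho (k := k) (Hc gA gB) = 3 := by
  refine (Hc_map (rho (k := k)).toRingHom gA gB).trans ?_
  rw [rho_gA, rho_gB]; simp [Hc, sliceA, sliceB]; ring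
lemma rho_I : rho (k := k) (Ic gA gB) = -6 + 216 * (X 0 * (X 0 + 1)) - 24 * (X 1 * X 2) := by
  refine (Ic_map (rho (k := k)).toRingHom gA gB).trans ?_
  rw [rho_gA, rho_gB]; simp [Ic, sliceA, sliceB]; ring
lemma rho_R : rho (k := k) (Rc gA gB) = 1 + (X 1 ^ 3 - X 2 ^ 3 + 3 * (X 1 * X 2)) := by
  refine (Rc_map (rho (k := k)).toRingHom gA gB).trans ?_
  rw [rho_gA, rho_gB]; simp [Rc, sliceA, sliceB]; ring
lemma rho_d : rho (k := k) (discCubic gA) = -27 := by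
  refine (discCubic_map (rho (k := k)).toRingHom gA).trans ?_
  rw [rho_gA]; simp [discCubic, sliceA]
lemma rho_D : rho (k := k) (Dc gA gB) = -27 * (-27 * X 0 ^ 2 * (X 0 + 1) ^ 2
    + 18 * X 0 * (X 0 + 1) * X 2 * X 1 + X 1 ^ 2 * X 2 ^ 2
      - 4 * X 1 ^ 3 * (X 0 + 1) - 4 * X 2 ^ 3 * X 0) := by
  refine (Dc_map (rho (k := k)).toRingHom gA gB).trans ?_
  rw [rho_gA, rho_gB]; simp [Dc, discCubic, sliceA, sliceB]
lemma rho_J : rho (k := k) (Jc gA gB) = 729 * (X 1 * X 2) := by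
  refine (Jc_map (rho (k := k)).toRingHom gA gB).trans ?_
  rw [rho_gA, rho_gB]; simp [Jc, hsA, hsB, hsC, ln0, ln1, sliceA, sliceB]; ring

lemma rho_I_ne (h2 : (2 : k) ≠ 0) (h3 : (3 : k) ≠ 0) : rho (k := k) (Ic gA gB) ≠ 0 := by
  rw [rho_I]
  intro h
  have := congrArg (eval ![0, 0, 0]) h
  simp at this
  have h6 : (6 : k) = 2 * 3 := by norm_num
  rw [h6] at this
  exact mul_ne_zero h2 h3 this
lemma rho_R_ne : rho (k := k) (Rc gA gB) ≠ 0 := by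
  rw [rho_R]
  intro h
  have := congrArg (eval ![0, 0, 0]) h
  simp at this
lemma rho_D_ne (h2 : (2 : k) ≠ 0) (h3 : (3 : k) ≠ 0) : rho (k := k) (Dc gA gB) ≠ 0 := by
  rw [rho_D]
  intro h
  have := congrArg (eval ![1, 0, 0]) h
  simp only [map_mul, map_add, map_sub, map_neg, map_pow, map_ofNat, eval_X, map_one, map_zero] at this
  simp at this
  have h27 : (27 : k) = 3 ^ 3 := by norm_num
  rw [h27] at this
  have h11 : (1 + 1 : k) = 2 := by norm_num
  simp [h3, h11, h2] at this

lemma gen_top (B : IntermediateField k (FractionRing (MvPolynomial (Fin 3) k)))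
    (h : ∀ i, algebraMap (MvPolynomial (Fin 3) k) (FractionRing (MvPolynomial (Fin 3) k)) (X i) ∈ B)
    (e : FractionRing (MvPolynomial (Fin 3) k)) : e ∈ B := by
  have hp : ∀ p : MvPolynomial (Fin 3) k,
      algebraMap (MvPolynomial (Fin 3) k) (FractionRing (MvPolynomial (Fin 3) k)) p ∈ B := by
    intro p
    induction p using MvPolynomial.induction_on with
    | C a =>
      rw [← MvPolynomial.algebraMap_eq, ← IsScalarTower.algebraMap_apply]
      exact B.algebraMap_mem a
    | add p q hp hq => rw [map_add]; exact add_mem hp hq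
    | mul_X p i hp => rw [map_mul]; exact mul_mem hp (h i)
  obtain ⟨p, q, -, rfl⟩ := IsFractionRing.div_surjective (MvPolynomial (Fin 3) k) e
  exact div_mem (hp p) (hp q)

local notation "φ" => algebraMap (PairRing k) (FractionRing (PairRing k))
local notation "ψ" => algebraMap (MvPolynomial (Fin 3) k) (FractionRing (MvPolynomial (Fin 3) k))

lemma slice_dec [IsAlgClosed k] (h2 : (2 : k) ≠ 0) (h3 : (3 : k) ≠ 0)
    (u : FractionRing (PairRing k)) (hu : u ∈ Lsmall k)
    (e : FractionRing (MvPolynomial (Fin 3) k)) (hue : Res rho u e)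
    (T : Set (FractionRing (MvPolynomial (Fin 3) k)))
    (hT : T = {ψ (rho (Hc gA gB)) ^ 2 / ψ (rho (Ic gA gB)), ψ (rho (Hc gA gB)) ^ 3 / ψ (rho (Rc gA gB)),
      ψ (rho (Hc gA gB)) ^ 4 / ψ (rho (Dc gA gB))})
    (hTr : ∀ x ∈ T, ∃ w ∈ Lsmall k, Res rho w x) :
    ∃ a b, a ∈ IntermediateField.adjoin k T ∧ b ∈ IntermediateField.adjoin k T ∧
      e = a + b * (ψ (X 1) * ψ (X 2)) := by
  obtain ⟨ρ, hρ⟩ := IsAlgClosed.exists_eq_mul_self (-3 : k)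
  obtain ⟨ω, hωd⟩ : ∃ ω, ω = (-1 + ρ) / 2 := ⟨_, rfl⟩
  have hω : 1 + ω + ω ^ 2 = 0 := by
    rw [hωd]; field_simp; linear_combination -hρ
  have ω3 : ω ^ 3 = 1 := by linear_combination (ω - 1) * hω
  have ω3' : (ω ^ 2) ^ 3 = 1 := by rw [← pow_mul, mul_comm, pow_mul, ω3, one_pow]
  have inj := IsFractionRing.injective (MvPolynomial (Fin 3) k)
    (FractionRing (MvPolynomial (Fin 3) k))
  have c2 : (2 : FractionRing (MvPolynomial (Fin 3) k)) ≠ 0 := by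
    intro h; apply h2
    apply (algebraMap k (FractionRing (MvPolynomial (Fin 3) k))).injective
    rw [map_ofNat, h, map_zero]
  have c3 : (3 : FractionRing (MvPolynomial (Fin 3) k)) ≠ 0 := by
    intro h; apply h3
    apply (algebraMap k (FractionRing (MvPolynomial (Fin 3) k))).injective
    rw [map_ofNat, h, map_zero]
  have eI := congrArg ψ (rho_I (k := k))
  have eR := congrArg ψ (rho_R (k := k))
  have eD := congrArg ψ (rho_D (k := k))
  have nI := aM_ne (rho_I_ne h2 h3)
  have nR := aM_ne (rho_R_ne (k := k))
  have nD := aM_ne (rho_D_ne h2 h3)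
  simp only [rho_H, map_ofNat] at hT
  obtain ⟨I, hI⟩ : ∃ x, x = ψ (rho (Ic gA gB)) := ⟨_, rfl⟩
  obtain ⟨R, hR⟩ : ∃ x, x = ψ (rho (Rc gA gB)) := ⟨_, rfl⟩
  obtain ⟨D, hD⟩ : ∃ x, x = ψ (rho (Dc gA gB)) := ⟨_, rfl⟩
  rw [← hI] at eI nI hT
  rw [← hR] at eR nR hT
  rw [← hD] at eD nD hT
  simp only [map_add, map_sub, map_mul, map_neg, map_pow, map_ofNat, map_one] at eI eR eD
  have hsub : ∀ x ∈ T, x ∈ IntermediateField.adjoin k T :=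
    fun x hx => IntermediateField.subset_adjoin _ _ hx
  have t1 := hsub (3 ^ 2 / I) (by rw [hT]; simp)
  have t2 := hsub (3 ^ 3 / R) (by rw [hT]; simp)
  have t3 := hsub (3 ^ 4 / D) (by rw [hT]; simp)
  have c27 : (27 : FractionRing (MvPolynomial (Fin 3) k)) ≠ 0 := by
    rw [show (27 : FractionRing (MvPolynomial (Fin 3) k)) = 3 ^ 3 by norm_num]
    exact pow_ne_zero _ c3
  have c24 : (24 : FractionRing (MvPolynomial (Fin 3) k)) ≠ 0 := by
    rw [show (24 : FractionRing (MvPolynomial (Fin 3) k)) = 2 ^ 3 * 3 by norm_num]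
    exact mul_ne_zero (pow_ne_zero _ c2) c3
  have mI : I ∈ IntermediateField.adjoin k T := by
    rw [show I = 3 ^ 2 / (3 ^ 2 / I) by field_simp]
    exact div_mem (pow_mem (ofNat_mem _ 3) 2) t1
  have mR : R ∈ IntermediateField.adjoin k T := by
    rw [show R = 3 ^ 3 / (3 ^ 3 / R) by field_simp]
    exact div_mem (pow_mem (ofNat_mem _ 3) 3) t2
  have mD : D ∈ IntermediateField.adjoin k T := by
    rw [show D = 3 ^ 4 / (3 ^ 4 / D) by field_simp]
    exact div_mem (pow_mem (ofNat_mem _ 3) 4) t3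
  have cω : 1 + ψ (C ω) + ψ (C ω) ^ 2 = 0 := by
    rw [← map_pow, ← map_one ψ, ← map_add, ← map_add, ← C_1, ← C_pow, ← C_add, ← C_add, hω,
      C_0, map_zero]
  have cω4 : ψ (C ω) ^ 4 = ψ (C ω) := by
    rw [← map_pow, ← C_pow, pow_succ, ω3, one_mul]
  refine tower c2 c3 (ψ (X 0)) (ψ (X 1)) (ψ (X 2)) (ψ (C ω))
    (fun B h0 h1 h2 e => gen_top B (fun i => by fin_cases i; exacts [h0, h1, h2]) e) cω
    (extF (sig1 ω) (sig1_inj ω ω3)) (extF (sig1 (ω ^ 2)) (sig1_inj _ ω3')) (extF sig2 sig2_inj)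
    ?_ ?_ ?_ ?_ ?_ ?_ ?_ ?_ ?_ (IntermediateField.adjoin k T) ((I + 6) / 24) (R - 1) (-(D / 27))
    ?_ ?_ ?_ ?_ ?_ ?_ ?_ ?_ ?_ ?_ ?_ ?_ e ?_ ?_ ?_
  · rw [extF_algebraMap]; simp [sig1]
  · rw [extF_algebraMap]; simp [sig1]
  · rw [extF_algebraMap]; simp [sig1]
  · rw [extF_algebraMap]; simp [sig1]
  · rw [extF_algebraMap]; simp [sig1]
  · rw [extF_algebraMap]; simp [sig1]
    rw [← pow_mul]; exact cω4
  · rw [extF_algebraMap]; simp [sig2]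
  · rw [extF_algebraMap]; simp [sig2]
  · rw [extF_algebraMap]; simp [sig2]
  · rw [eI]; field_simp; ring
  · rw [eR]; ring
  · rw [eD]; field_simp
  · exact div_mem (add_mem mI (ofNat_mem _ 6)) (ofNat_mem _ 24)
  · exact sub_mem mR (one_mem _)
  · exact neg_mem (div_mem mD (ofNat_mem _ 27))
  · exact neg_ne_zero.2 (div_ne_zero nD c27)
  · exact aM_ne (X_ne_zero 1)
  · have : (2 * X 0 + 1 : MvPolynomial (Fin 3) k) ≠ 0 := by
      intro h
      have := congrArg (eval ![0, 0, 0]) h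
      simp at this
    have := aM_ne this
    simpa only [map_add, map_mul, map_ofNat, map_one] using this
  · rw [IntermediateField.adjoin_le_iff]
    intro x hx
    obtain ⟨w, hw, hr⟩ := hTr x hx
    exact sig1_fix _ ω3 w hw x hr
  · rw [IntermediateField.adjoin_le_iff]
    intro x hx
    obtain ⟨w, hw, hr⟩ := hTr x hx
    exact sig1_fix _ ω3' w hw x hr
  · rw [IntermediateField.adjoin_le_iff]
    intro x hx
    obtain ⟨w, hw, hr⟩ := hTr x hx
    exact sig2_fix w hw x hr
  · exact sig1_fix _ ω3 u hu e hue
  · exact sig1_fix _ ω3' u hu e hue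
  · exact sig2_fix u hu e hue

lemma main_le [IsAlgClosed k] (h2 : (2 : k) ≠ 0) (h3 : (3 : k) ≠ 0)
    (u : FractionRing (PairRing k)) (hu : u ∈ Lfull k) :
    u ∈ IntermediateField.adjoin k ({φ (Hc gA gB) ^ 2 / φ (Ic gA gB),
      φ (Hc gA gB) ^ 3 / φ (Rc gA gB), φ (Hc gA gB) ^ 4 / φ (Dc gA gB)} :
      Set (FractionRing (PairRing k))) := by
  obtain ⟨K, hK⟩ : ∃ K, K = IntermediateField.adjoin k ({φ (Hc gA gB) ^ 2 / φ (Ic gA gB),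
      φ (Hc gA gB) ^ 3 / φ (Rc gA gB), φ (Hc gA gB) ^ 4 / φ (Dc gA gB)} :
      Set (FractionRing (PairRing k))) := ⟨_, rfl⟩
  rw [← hK]
  obtain ⟨r1, r2, r3⟩ := R_full (k := k)
  have KL : K ≤ Lfull k := by
    rw [hK, IntermediateField.adjoin_le_iff]
    rintro x (rfl | rfl | rfl)
    exacts [r1, r2, r3]
  have LL : Lfull k ≤ Lsmall k := inf_le_left
  rcases eq_or_ne u 0 with rfl | hu0
  · exact zero_mem _
  obtain ⟨e, -, hue⟩ := exists_res h2 h3 u (LL hu) hu0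
  obtain ⟨T, hT⟩ : ∃ T : Set (FractionRing (MvPolynomial (Fin 3) k)), T =
    {ψ (rho (Hc gA gB)) ^ 2 / ψ (rho (Ic gA gB)), ψ (rho (Hc gA gB)) ^ 3 / ψ (rho (Rc gA gB)),
      ψ (rho (Hc gA gB)) ^ 4 / ψ (rho (Dc gA gB))} := ⟨_, rfl⟩
  have hTK : ∀ x ∈ T, ∃ w ∈ K, Res rho w x := by
    rw [hT, hK]
    rintro x (rfl | rfl | rfl)
    · exact ⟨_, IntermediateField.subset_adjoin _ _ (by simp),
        ((Res.poly _).pow 2).div (Res.poly _) (aM_ne (rho_I_ne h2 h3))⟩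
    · exact ⟨_, IntermediateField.subset_adjoin _ _ (by simp),
        ((Res.poly _).pow 3).div (Res.poly _) (aM_ne rho_R_ne)⟩
    · exact ⟨_, IntermediateField.subset_adjoin _ _ (by simp),
        ((Res.poly _).pow 4).div (Res.poly _) (aM_ne (rho_D_ne h2 h3))⟩
  obtain ⟨a, b, ha, hb, he⟩ := slice_dec h2 h3 u (LL hu) e hue T hT
    (fun x hx => by
      obtain ⟨w, hw, h⟩ := hTK x hx
      exact ⟨w, LL (KL hw), h⟩)
  obtain ⟨a', ha', hra⟩ := Res.adjoin K T hTK a ha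
  obtain ⟨b', hb', hrb⟩ := Res.adjoin K T hTK b hb
  by_cases hb0 : b = 0
  · rw [hb0, zero_mul, add_zero] at he
    rw [he] at hue
    rw [res_inj h2 h3 u a' (LL hu) (LL (KL ha')) a hue hra]
    exact ha'
  · exfalso
    have hv : Res rho ((u - a') / b') (ψ (X 1) * ψ (X 2)) := by
      have := (hue.sub hra).div hrb hb0
      rwa [he, add_sub_cancel_left, mul_div_cancel_left₀ _ hb0] at this
    have hvL : (u - a') / b' ∈ Lfull k := div_mem (sub_mem hu (KL ha')) (KL hb')
    have c3 : (3 : MvPolynomial (Fin 3) k) ≠ 0 := by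
      intro h; apply h3
      apply C_injective (Fin 3) k
      rw [map_ofNat, h, map_zero]
    have c27 : (-27 : MvPolynomial (Fin 3) k) ≠ 0 := by
      rw [show (-27 : MvPolynomial (Fin 3) k) = -(3 ^ 3) by norm_num]
      exact neg_ne_zero.2 (pow_ne_zero _ c3)
    have hN : Res rho (Nfun : FractionRing (PairRing k))
        (algebraMap k _ (-3) * (ψ (X 1) * ψ (X 2))) := by
      have := (Res.poly (ρ := rho (k := k)) (Jc gA gB)).div
        ((Res.poly (ρ := rho (k := k)) (discCubic gA)).mul
          ((Res.poly (ρ := rho (k := k)) (Hc gA gB)).pow 2))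
        (by
          rw [rho_d, rho_H]
          exact mul_ne_zero (aM_ne c27) (pow_ne_zero _ (aM_ne c3)))
      unfold Nfun
      convert this using 1
      have d3 := aM_ne c3
      rw [rho_J, rho_d, rho_H]
      simp only [map_mul, map_neg, map_ofNat] at d3 ⊢
      rw [show (729 : FractionRing (MvPolynomial (Fin 3) k)) = 3 ^ 6 by norm_num,
        show (27 : FractionRing (MvPolynomial (Fin 3) k)) = 3 ^ 3 by norm_num]
      field_simp
    have := res_inj h2 h3 _ _ Nfun_small (mul_mem ((Lsmall k).algebraMap_mem (-3)) (LL hvL)) _ hN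
      ((Res.const (-3)).mul hv)
    apply Nfun_swap (k := k) h3
    rw [this]
    exact mul_mem ((Lfull k).algebraMap_mem (-3)) hvL

end

/-- The field of `GL₂(k) × Γ`-invariant rational functions on pairs of binary cubics
is the rational function field `k(R₁, R₂, R₃)`, where `R₁ = H²/I`, `R₂ = H³/R`,
`R₃ = H⁴/D`. -/
theorem invariant_function_field_of_cubic_pairs
    (k : Type*) [Field k] [IsAlgClosed k]
    (h2 : (2 : k) ≠ 0) (h3 : (3 : k) ≠ 0) :
    letI F := FractionRing (PairRing k)
    letI φ := algebraMap (PairRing k) F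
    letI Hp : PairRing k := Hc (fun i => X (Sum.inl i)) (fun i => X (Sum.inr i))
    letI Ip : PairRing k := Ic (fun i => X (Sum.inl i)) (fun i => X (Sum.inr i))
    letI Rp : PairRing k := Rc (fun i => X (Sum.inl i)) (fun i => X (Sum.inr i))
    letI Dp : PairRing k := Dc (fun i => X (Sum.inl i)) (fun i => X (Sum.inr i))
    {u : F | PairRatInvariant k u} =
      (IntermediateField.adjoin k
        ({(φ Hp)^2 / φ Ip, (φ Hp)^3 / φ Rp, (φ Hp)^4 / φ Dp} : Set F) :
        IntermediateField k F) := by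

  apply Set.Subset.antisymm
  · intro u hu
    exact main_le h2 h3 u ((mem_Lfull u).2 hu)
  · intro u hu
    refine (mem_Lfull u).1 ?_
    refine (IntermediateField.adjoin_le_iff (T := Lfull k)).2 ?_ hu
    rintro x (rfl | rfl | rfl)
    exacts [(R_full (k := k)).1, (R_full (k := k)).2.1, (R_full (k := k)).2.2]
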